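/- Let $m,n$ be positive integers and write $[n]=\{1,\dots,n\}$. For an integer $p\ge 0$ let $\mathcal A_p^n$ be the arrangement (set of hyperplanes of $\mathbb R^n$) $\{\{x_i-x_j=s\} : 1\le i<j\le n,\ s\in\mathbb Z,\ -p\le s\le p\}$. Let $R_n:=\{(i,j)\in[n]^2: i\ne j\}$ and let $I\subseteq R_n$ be an ideal, that is: whenever $(i,j)\in I$, $(i',j')\in R_n$, $i'\le i$ and $j'\ge j$, then $(i',j')\in I$. Set $$\mathcal A=\mathcal B_{m,I}^n:=\mathcal A_{m-1}^n\cup\{\{x_i-x_j=m\} : (i,j)\in I\}.$$ *Faces.* A face of $\mathcal A$ is a nonempty set $\bigcap_{H\in\mathcal A}\sigma_H$, where each $\sigma_H$ is either $H$ or one of the two open half-spaces bounded by $H$ (if $\mathcal A=\emptyset$, the only face is $\mathbb R^n$); its codimension is the codimension of its affine hull. *Trees.* An $(m,n)$-tree is a rooted tree with $n$ internal nodes labeled bijectively by $[n]$ (and identified with their labels) and unlabeled leaves, in which each node $j$ has $m+1$ ordered children $0\text{-child}(j),\dots,m\text{-child}(j)$, each of them a node or a leaf. A node $i$ is the $s$-cadet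 of the node $j$ if $i=s\text{-child}(j)$ and $t\text{-child}(j)$ is a leaf for all $s<t\le m$; then $\{i,j\}$ is a cadet edge. If the path from the root to a vertex $v$ (node or leaf) has successive child-indices $(s_1,\dots,s_k)$, let $\mathrm{drift}_T(v):=s_1+\dots+s_k$. For distinct vertices $v,w$ with child-indices $(s_1,\dots,s_k)$ and $(t_1,\dots,t_\ell)$, put $v\prec_T w$ if $\mathrm{drift}_T(v)<\mathrm{drift}_T(w)$, or if $\mathrm{drift}_T(v)=\mathrm{drift}_T(w)$ and there is $c\le \min(k,\ell)$ with $(s_1,\dots,s_c)=(t_1,\dots,t_c)$ such that $c=k$, or $c<\min(k,\ell)$ and $s_{c+1}>t_{c+1}$. This is a strict total order; $v\succeq_T w$ means $w\prec_T v$ or $v=w$. *Marked trees.* A marked $(m,n)$-tree is a pair $(T,\mu)$, where $T$ is an $(m,n)$-tree and $\mu$ is a set of cadet edges of $T$ (the marked edges) such that $j<i$ whenever $\{i,j\}\in\mu$ and $i$ is the $0$-cadet of $j$. Write $i\sim_\mu j$ if $i=j$ or all edges on the path of $T$ between the nodes $i$ and $j$ are marked; the classes of this equivalence relation are the blocks.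 Let $\overline{\mathcal T}_m^n(\mathcal A)$ be the set of marked $(m,n)$-trees $(T,\mu)$ such that * for every block $B$, the graph with vertex set $B$ and with an edge between distinct $i,j\in B$ whenever $\{x_i-x_j=\mathrm{drift}_T(i)-\mathrm{drift}_T(j)\}\in\mathcal A$ is connected; and * for every non-marked cadet edge $\{i,j\}$, with $i$ the $s$-cadet of $j$, either $s=0$ and $i<j$, or there are $i'\sim_\mu i$ and $j'\sim_\mu j$ with $\{x_{i'}-x_{j'}=\mathrm{drift}_T(i')-\mathrm{drift}_T(j')\}\in\mathcal A$. Let $\mathrm{Tr}(\mathcal A)$ be the set of triples $(i,j,s)$ with $i,j\in[n]$, $i\ne j$, $s\in\{0,\dots,m\}$, ($s>0$ or $i>j$) and $\{x_i-x_j=s\}\in\mathcal A$. For a marked $(m,n)$-tree $(T,\mu)$ let $\overline\Phi_{\mathcal A}(T,\mu)$ be the set of all $x\in\mathbb R^n$ such that $x_i-x_j=s$ whenever $\{i,j\}\in\mu$ and $i=s\text{-child}(j)$, and such that for all $(i,j,s)\in\mathrm{Tr}(\mathcal A)$ with $i\not\sim_\mu j$ one has $x_i-x_j<s$ if $i\prec_T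 s\text{-child}(j)$, and $x_i-x_j>s$ if $i\succeq_T s\text{-child}(j)$. **Statement.** 1. $\mathcal A\subseteq\mathcal A_m^n$, and $\mathcal A$ is strongly transitive: for all distinct $i,j,k\in[n]$ and all integers $s,t\ge0$, if $\{x_i-x_j=s\}\notin\mathcal A$ and $\{x_j-x_k=t\}\notin\mathcal A$, then $\{x_i-x_k=s+t\}\notin\mathcal A$. 2. $\overline{\mathcal T}_m^n(\mathcal A)$ equals the set of marked $(m,n)$-trees $(T,\mu)$ such that $(i,j)\in I$ whenever $i=m\text{-child}(j)$ for nodes $i,j\in[n]$ of $T$. 3. Consequently, for each integer $k\ge0$, the map $\overline\Phi_{\mathcal A}$ is a bijection from the set of marked $(m,n)$-trees $(T,\mu)$ with exactly $k$ marked edges such that $(i,j)\in I$ whenever $i=m\text{-child}(j)$ for nodes $i,j$ of $T$, onto the set of faces of $\mathcal A$ of codimension $k$. -/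

import Mathlib

namespace Braid

/-- The hyperplane `{x ∈ ℝ^n | x i - x j = s}`. Indices in `[n]` are represented by `Fin n`. -/
def hyp (n : ℕ) (i j : Fin n) (s : ℝ) : Set (Fin n → ℝ) := {x | x i - x j = s}

/-- The `m`-Catalan arrangement `A_m^n`, as a set of hyperplanes. -/
def catArr (m n : ℕ) : Set (Set (Fin n → ℝ)) :=
  {H | ∃ i j : Fin n, ∃ s : ℤ, i < j ∧ -(m : ℤ) ≤ s ∧ s ≤ (m : ℤ) ∧ H = hyp n i j (s : ℝ)}

/-- `(i,j,s) ∈ Tr_m^n`. -/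
def TrIdx (m n : ℕ) (i j : Fin n) (s : ℕ) : Prop := s ≤ m ∧ i ≠ j ∧ (0 < s ∨ j < i)

/-- `(i,j,s) ∈ Tr_m^n(A)`. -/
def TrIdxA (m n : ℕ) (A : Set (Set (Fin n → ℝ))) (i j : Fin n) (s : ℕ) : Prop :=
  TrIdx m n i j s ∧ hyp n i j (s : ℝ) ∈ A

/-- The strong transitivity condition on an arrangement. -/
def IsStronglyTransitive (n : ℕ) (A : Set (Set (Fin n → ℝ))) : Prop :=
  ∀ i j k : Fin n, i ≠ j → j ≠ k → i ≠ k → ∀ s t : ℕ,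
    hyp n i j (s : ℝ) ∉ A → hyp n j k (t : ℝ) ∉ A → hyp n i k ((s : ℝ) + (t : ℝ)) ∉ A

/-- An `(m,n)`-tree: a rooted `(m+1)`-ary tree with `n` nodes labeled by `Fin n`
(leaves unlabeled), encoded by the root-to-node lists of child indices. The vertices of the
tree are the nodes and the leaves; the vertex `s`-child`(j)`, node or leaf, has
path `path j ++ [s]`. -/
structure Tree (m n : ℕ) where
  path : Fin n → List ℕ
  entry_le : ∀ v : Fin n, ∀ s ∈ path v, s ≤ m
  inj : Function.Injective path
  parent_closed : ∀ v : Fin n, path v ≠ [] → ∃ w : Fin n, path w = (path v).dropLast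

namespace Tree

variable {m n : ℕ}

/-- The drift of a node. -/
def drift (T : Tree m n) (v : Fin n) : ℕ := (T.path v).sum

/-- The node `i` is `s`-child`(j)`. -/
def IsChild (T : Tree m n) (i j : Fin n) (s : ℕ) : Prop := T.path i = T.path j ++ [s]

/-- The node `i` is `s`-cadet`(j)`: `i = s`-child`(j)`, and `t`-child`(j)` is a leaf
(that is, no node) for all `t ∈ [s+1;m]`. -/
def IsCadet (T : Tree m n) (i j : Fin n) (s : ℕ) : Prop :=
  T.IsChild i j s ∧ ∀ t : ℕ, s < t → t ≤ m → ¬ ∃ i' : Fin n, T.IsChild i' j t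

end Tree

/-- The strict order `≺_T` on the vertices of a tree, expressed on root-to-vertex paths:
`v ≺_T w` iff `v`, `w` are distinct and either `drift(v) < drift(w)`, or the drifts are equal
and there is `c ≤ k` (`k` the length of the path of `v`) such that the first `c` entries of
both paths are equal and `c = k` or the entry number `c+1` of the path of `v` is larger than
that of the path of `w`. -/
def vlt (p q : List ℕ) : Prop :=
  p ≠ q ∧ (p.sum < q.sum ∨
    (p.sum = q.sum ∧ ∃ c ≤ p.length, p.take c = q.take c ∧
      (c = p.length ∨ ∃ (h1 : c < p.length) (h2 : c < q.length), q[c] < p[c])))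

/-- `v ≽_T w`. -/
def vge (p q : List ℕ) : Prop := vlt q p ∨ p = q

/-- `(T,μ)` is a marked tree: `μ` is a set of cadet edges of `T`, and every edge of `μ` of the
form `{j, 0`-cadet`(j)}` satisfies `j < 0`-cadet`(j)`. -/
def IsMarking {m n : ℕ} (T : Tree m n) (μ : Set (Sym2 (Fin n))) : Prop :=
  (∀ e ∈ μ, ∃ i j : Fin n, ∃ s : ℕ, e = s(i, j) ∧ T.IsCadet i j s) ∧
  ∀ i j : Fin n, s(i, j) ∈ μ → T.IsCadet i j 0 → j < i

/-- The relation `i ∼_μ j`: `i` and `j` are joined by a (possibly empty) path of marked edges.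
The edges in `μ` being edges of a tree, this means that `i = j` or that all the edges
on the path of the tree between `i` and `j` are marked. -/
def simMu {n : ℕ} (μ : Set (Sym2 (Fin n))) : Fin n → Fin n → Prop :=
  Relation.ReflTransGen (fun a b => s(a, b) ∈ μ)

/-- The block containing the node `i`. -/
def blockOf {n : ℕ} (μ : Set (Sym2 (Fin n))) (i : Fin n) : Set (Fin n) :=
  {j | simMu μ i j}

/-- The set of nodes `B` is `A`-connected. -/
def BlockConnected {m n : ℕ} (A : Set (Set (Fin n → ℝ))) (T : Tree m n)
    (B : Set (Fin n)) : Prop :=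
  (SimpleGraph.fromRel (fun a b : B =>
    hyp n a b ((T.drift a : ℝ) - (T.drift b : ℝ)) ∈ A)).Connected

/-- The marked tree `(T,μ)` is `A`-connected: all its blocks are. -/
def AConnected {m n : ℕ} (A : Set (Set (Fin n → ℝ))) (T : Tree m n)
    (μ : Set (Sym2 (Fin n))) : Prop :=
  ∀ i : Fin n, BlockConnected A T (blockOf μ i)

/-- The `A`-cadet condition. -/
def CadetCond {m n : ℕ} (A : Set (Set (Fin n → ℝ))) (T : Tree m n)
    (μ : Set (Sym2 (Fin n))) : Prop :=
  ∀ (i j : Fin n) (s : ℕ), T.IsCadet i j s → s(i, j) ∉ μ →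
    ((s = 0 ∧ i < j) ∨
      ∃ i' j' : Fin n, simMu μ i' i ∧ simMu μ j' j ∧
        hyp n i' j' ((T.drift i' : ℝ) - (T.drift j' : ℝ)) ∈ A)

/-- The set of all marked `(m,n)`-trees. -/
def OTall (m n : ℕ) : Set (Tree m n × Set (Sym2 (Fin n))) := {p | IsMarking p.1 p.2}

/-- The set of the marked `(m,n)`-trees that are `A`-connected and satisfy the `A`-cadet
condition. -/
def OTset (m n : ℕ) (A : Set (Set (Fin n → ℝ))) : Set (Tree m n × Set (Sym2 (Fin n))) :=
  {p | IsMarking p.1 p.2 ∧ AConnected A p.1 p.2 ∧ CadetCond A p.1 p.2}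

/-- The polyhedron `Φ̄_A(T,μ)`. -/
def PhiBar (m n : ℕ) (A : Set (Set (Fin n → ℝ))) (T : Tree m n) (μ : Set (Sym2 (Fin n))) :
    Set (Fin n → ℝ) :=
  {x | (∀ (i j : Fin n) (s : ℕ), s(i, j) ∈ μ → T.IsChild i j s → x i - x j = (s : ℝ)) ∧
       ∀ (i j : Fin n) (s : ℕ), TrIdxA m n A i j s → ¬ simMu μ i j →
         (vlt (T.path i) (T.path j ++ [s]) → x i - x j < (s : ℝ)) ∧
         (vge (T.path i) (T.path j ++ [s]) → (s : ℝ) < x i - x j)}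

/-- `σ` is the hyperplane `H` itself or one of the two open half-spaces bounded by `H`. -/
def IsSideOf (n : ℕ) (σ H : Set (Fin n → ℝ)) : Prop :=
  σ = H ∨ ∃ (i j : Fin n) (s : ℝ), i ≠ j ∧ H = hyp n i j s ∧
    (σ = {x | x i - x j < s} ∨ σ = {x | s < x i - x j})

/-- `F` is a face of the arrangement `A`. -/
def IsFace (n : ℕ) (A : Set (Set (Fin n → ℝ))) (F : Set (Fin n → ℝ)) : Prop :=
  F.Nonempty ∧ ∃ σ : Set (Fin n → ℝ) → Set (Fin n → ℝ),
    (∀ H ∈ A, IsSideOf n (σ H) H) ∧ F = ⋂ H ∈ A, σ H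

/-- The dimension of the affine hull of a nonempty subset of `ℝ^n`. -/
noncomputable def faceDim (n : ℕ) (F : Set (Fin n → ℝ)) : ℕ :=
  Module.finrank ℝ (affineSpan ℝ F).direction

/-- `I` is an ideal of `R_n = {(i,j) ∈ [n]² | i ≠ j}`: `I ⊆ R_n` and whenever `(i,j) ∈ I`,
`(i',j') ∈ R_n`, `i' ≤ i` and `j' ≥ j`, one has `(i',j') ∈ I`. -/
def IsIdeal (n : ℕ) (I : Set (Fin n × Fin n)) : Prop :=
  (∀ p ∈ I, p.1 ≠ p.2) ∧
  ∀ p ∈ I, ∀ q : Fin n × Fin n, q.1 ≠ q.2 → q.1 ≤ p.1 → p.2 ≤ q.2 → q ∈ I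

/-- The arrangement `B_{m,I}^n = A_{m-1}^n ∪ (⋃_{(i,j) ∈ I} {x_i - x_j = m})`, for `m ≥ 1`. -/
def BmI (m n : ℕ) (I : Set (Fin n × Fin n)) : Set (Set (Fin n → ℝ)) :=
  catArr (m - 1) n ∪ {H | ∃ p ∈ I, H = hyp n p.1 p.2 (m : ℝ)}

end Braid

namespace Braid

/-- The word of opposite entries; its lexicographic order is the preorder traversal in which
larger child indices are visited first. -/
def pre (p : List ℕ) : List ℤ := p.map (fun a : ℕ => -(a : ℤ))

/-- The key whose order is the order `≺_T` on vertices. -/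
def vkey (p : List ℕ) : ℕ ×ₗ List ℤ := toLex (p.sum, pre p)

@[simp] lemma pre_nil : pre [] = [] := rfl

@[simp] lemma pre_cons (a : ℕ) (p : List ℕ) : pre (a :: p) = -(a : ℤ) :: pre p := rfl

lemma pre_append (p q : List ℕ) : pre (p ++ q) = pre p ++ pre q := by
  simp [pre]

lemma pre_injective : Function.Injective pre := by
  unfold pre
  exact List.map_injective_iff.2 fun a b h => by simpa using h

lemma vkey_injective : Function.Injective vkey := fun p q h => by
  have h' := congrArg (fun z => (ofLex z).2) h
  exact pre_injective h'

lemma vkey_lt {p q : List ℕ} :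
    vkey p < vkey q ↔ p.sum < q.sum ∨ p.sum = q.sum ∧ pre p < pre q := by
  simp [vkey, Prod.Lex.toLex_lt_toLex]

lemma pre_cons_lt_cons {a b : ℕ} {p q : List ℕ} :
    pre (a :: p) < pre (b :: q) ↔ b < a ∨ a = b ∧ pre p < pre q := by
  simp [List.cons_lt_cons_iff]

lemma pre_lt_iff (p q : List ℕ) :
    pre p < pre q ↔ p ≠ q ∧ ∃ c ≤ p.length, p.take c = q.take c ∧
      (c = p.length ∨ ∃ (h1 : c < p.length) (h2 : c < q.length), q[c] < p[c]) := by
  induction p generalizing q with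
  | nil => cases q <;> simp
  | cons a p ih =>
    cases q with
    | nil =>
      simp
    | cons b q =>
      rw [pre_cons_lt_cons, ih]
      constructor
      · rintro (h | ⟨rfl, hne, c, hc, htake, h⟩)
        · exact ⟨by simp; omega, 0, by simp, by simp, Or.inr ⟨by simp, by simp, by simpa using h⟩⟩
        · refine ⟨by simpa using hne, c + 1, by simpa using hc, by simpa using htake, ?_⟩
          rcases h with h | ⟨h1, h2, h⟩
          · left; simp [h]
          · right; exact ⟨by simpa using h1, by simpa using h2, by simpa using h⟩
      · rintro ⟨hne, c, hc, htake, h⟩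
        cases c with
        | zero =>
          rcases h with h | ⟨h1, h2, h⟩
          · simp at h
          · left; simpa using h
        | succ c =>
          simp only [List.take_succ_cons, List.cons.injEq] at htake
          obtain ⟨rfl, htake⟩ := htake
          refine Or.inr ⟨rfl, by simpa using hne, c, by simpa using hc, htake, ?_⟩
          rcases h with h | ⟨h1, h2, h⟩
          · left; simpa using h
          · right; exact ⟨by simpa using h1, by simpa using h2, by simpa using h⟩

lemma vlt_iff {p q : List ℕ} : vlt p q ↔ vkey p < vkey q := by
  rw [vkey_lt, pre_lt_iff, vlt]
  constructor
  · rintro ⟨hne, h | ⟨h, h'⟩⟩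
    · exact Or.inl h
    · exact Or.inr ⟨h, hne, h'⟩
  · rintro (h | ⟨h, hne, h'⟩)
    · exact ⟨fun e => by simp [e] at h, Or.inl h⟩
    · exact ⟨hne, Or.inr ⟨h, h'⟩⟩

lemma vge_iff {p q : List ℕ} : vge p q ↔ vkey q ≤ vkey p := by
  rw [vge, vlt_iff, le_iff_lt_or_eq, vkey_injective.eq_iff, eq_comm (a := p)]

lemma vkey_le {p q : List ℕ} :
    vkey p ≤ vkey q ↔ p.sum < q.sum ∨ p.sum = q.sum ∧ pre p ≤ pre q := by
  simp [vkey, Prod.Lex.toLex_le_toLex]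

lemma pre_lt_append (p : List ℕ) {l : List ℕ} (hl : l ≠ []) : pre p < pre (p ++ l) := by
  induction p with
  | nil => cases l <;> simp_all
  | cons a p ih => simpa [pre_append] using ih

lemma vkey_lt_append (p : List ℕ) {l : List ℕ} (hl : l ≠ []) : vkey p < vkey (p ++ l) := by
  rw [vkey_lt]
  have := pre_lt_append p hl
  rcases Nat.eq_zero_or_pos l.sum with h | h
  · right; simp [h, this]
  · left; simp [h]

lemma vkey_nil_lt {p : List ℕ} (hp : p ≠ []) : vkey [] < vkey p := by
  simpa using vkey_lt_append [] hp

lemma vkey_append_singleton_le {p : List ℕ} {s t : ℕ} :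
    vkey (p ++ [s]) ≤ vkey (p ++ [t]) ↔ s ≤ t := by
  rw [vkey_le]
  constructor
  · rintro (h | ⟨h, -⟩) <;> simp at h <;> omega
  · intro h
    rcases h.eq_or_lt with rfl | h
    · right; simp
    · left; simpa using h

lemma pre_append_singleton_lt_of_le {p q : List ℕ} {t u : ℕ} (h : pre (p ++ [t]) ≤ pre q) :
    pre (p ++ [t + u]) < pre (q ++ [u]) := by
  induction p generalizing q with
  | nil =>
    cases q with
    | nil => rw [← not_lt] at h; simp at h
    | cons v z =>
      rw [← not_lt, List.nil_append, pre_cons_lt_cons] at h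
      push Not at h
      rw [List.nil_append, List.cons_append, pre_cons_lt_cons]
      rcases Nat.eq_zero_or_pos u with rfl | hu
      · rcases h.1.eq_or_lt with rfl | h'
        · right; exact ⟨by simp, by cases z <;> simp⟩
        · left; omega
      · left; omega
  | cons a p ih =>
    cases q with
    | nil => rw [← not_lt] at h; simp at h
    | cons b q =>
      rw [← not_lt, List.cons_append, pre_cons_lt_cons] at h
      push Not at h
      rw [List.cons_append, List.cons_append, pre_cons_lt_cons]
      rcases h.1.eq_or_lt with rfl | h'
      · exact Or.inr ⟨rfl, ih (h.2 rfl)⟩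
      · exact Or.inl h'

lemma pre_lt_of_lt_append_singleton {p q : List ℕ} {t : ℕ} (h : pre p < pre (q ++ [t]))
    (hne : p ≠ q) (hs : p.sum = q.sum + t) :
    pre p < pre q ∧ ∀ u, pre (p ++ [u]) < pre (q ++ [t + u]) := by
  induction q generalizing p with
  | nil =>
    cases p with
    | nil => simp at hne
    | cons v z =>
      simp only [List.nil_append, pre_cons_lt_cons, List.sum_cons, List.sum_nil] at h hs
      rcases h with h | ⟨rfl, h⟩
      · omega
      · simp at h
  | cons b q ih =>
    cases p with
    | nil =>
      refine ⟨by simp, fun u => ?_⟩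
      simp only [List.sum_nil, List.sum_cons] at hs
      rw [List.nil_append, List.cons_append, pre_cons_lt_cons]
      rcases Nat.eq_zero_or_pos u with rfl | hu
      · right; exact ⟨by omega, by cases q <;> simp⟩
      · left; omega
    | cons a p =>
      rw [List.cons_append, pre_cons_lt_cons] at h
      rw [pre_cons_lt_cons]
      simp only [List.cons_append, pre_cons_lt_cons]
      rcases h with h | ⟨rfl, h⟩
      · exact ⟨Or.inl h, fun u => Or.inl h⟩
      · have := ih h (by simpa using hne) (by simp only [List.sum_cons] at hs; omega)
        exact ⟨Or.inr ⟨rfl, this.1⟩, fun u => Or.inr ⟨rfl, this.2 u⟩⟩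

/-- Shifting both vertices by `u`, when the right one already lies above a child. -/
lemma vkey_shift_of_le {p q : List ℕ} {t : ℕ} (u : ℕ) (h : vkey (p ++ [t]) ≤ vkey q) :
    vkey (p ++ [t + u]) < vkey (q ++ [u]) := by
  rw [vkey_le] at h
  rw [vkey_lt]
  simp only [List.sum_append, List.sum_singleton] at h ⊢
  rcases h with h | ⟨h, h'⟩
  · left; omega
  · right; exact ⟨by omega, pre_append_singleton_lt_of_le h'⟩

lemma vkey_shift_of_lt {p q : List ℕ} {t : ℕ} (u : ℕ) (h : vkey p < vkey (q ++ [t]))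
    (hne : p ≠ q) : vkey (p ++ [u]) < vkey (q ++ [t + u]) := by
  rw [vkey_lt] at h ⊢
  simp only [List.sum_append, List.sum_singleton] at h ⊢
  rcases h with h | ⟨h, h'⟩
  · left; omega
  · right; exact ⟨by omega, (pre_lt_of_lt_append_singleton h' hne h).2 u⟩

lemma vkey_append_sum_le (p : List ℕ) {l : List ℕ} (hl : l ≠ []) :
    vkey (p ++ [l.sum]) ≤ vkey (p ++ l) := by
  rw [vkey_le]
  right
  refine ⟨by simp, ?_⟩
  induction p with
  | nil =>
    cases l with
    | nil => simp at hl
    | cons u z =>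
      rw [← not_lt, List.nil_append, List.nil_append, pre_cons_lt_cons]
      simp
  | cons a p ih =>
    rw [← not_lt] at ih ⊢
    rw [List.cons_append, List.cons_append, pre_cons_lt_cons]
    simpa using ih

/-- A word strictly between `p` and `p ++ [s]` in the traversal extends `p ++ [u]`, `u > s`. -/
lemma exists_prefix_of_pre_between {p a : List ℕ} {s : ℕ} (h1 : pre p < pre a)
    (h2 : pre a < pre (p ++ [s])) : ∃ u, s < u ∧ p ++ [u] <+: a := by
  induction p generalizing a with
  | nil =>
    cases a with
    | nil => simp at h1
    | cons u z =>
      rw [List.nil_append, pre_cons_lt_cons] at h2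
      rcases h2 with h2 | ⟨-, h2⟩
      · exact ⟨u, h2, by simp⟩
      · simp at h2
  | cons b p ih =>
    cases a with
    | nil => simp at h1
    | cons c z =>
      rw [List.cons_append, pre_cons_lt_cons] at h2
      rw [pre_cons_lt_cons] at h1
      have hbc : c = b := by omega
      subst hbc
      obtain ⟨u, hu, hz⟩ := ih (by simpa using h1) (by simpa using h2)
      exact ⟨u, hu, by simpa using hz⟩

end Braid

namespace Braid

variable {m n : ℕ}

lemma hyp_eq_hyp {i j i' j' : Fin n} {s s' : ℝ} (hij : i ≠ j) (hij' : i' ≠ j')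
    (h : hyp n i j s = hyp n i' j' s') :
    (i = i' ∧ j = j' ∧ s = s') ∨ (i = j' ∧ j = i' ∧ s = -s') := by
  have key : ∀ f : Fin n → ℝ, (if i' = i then s else if i' = j then 0 else f i') -
      (if j' = i then s else if j' = j then 0 else f j') = s' := fun f => by
    have : (fun v => if v = i then s else if v = j then 0 else f v) ∈ hyp n i j s := by
      simp [hyp, hij.symm]
    rw [h] at this
    exact this
  have k0 := key 0
  have k1 := key (Pi.single i' 1)
  have k2 := key (Pi.single j' 1)
  by_cases h1 : i' = i
  · subst h1
    by_cases h2 : j' = j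
    · subst h2
      left
      simpa [hij.symm] using k0
    · simp [hij'.symm, h2] at k0 k2
      linarith
  · by_cases h2 : i' = j
    · subst h2
      by_cases h3 : j' = i
      · subst h3
        right
        simp [hij'] at k0
        exact ⟨rfl, rfl, by linarith⟩
      · simp [h1, hij'.symm, h3] at k0 k2
        linarith
    · simp only [h1, h2, if_false, Pi.zero_apply, Pi.single_eq_same,
        Pi.single_eq_of_ne hij'.symm] at k0 k1
      linarith

/-- Membership of `x_i - x_j = s` in the arrangement, for `i ≠ j` and `s ≥ 0`. -/
def InA (m : ℕ) (I : Set (Fin n × Fin n)) (i j : Fin n) (s : ℕ) : Prop :=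
  s < m ∨ s = m ∧ (i, j) ∈ I

lemma InA.le {I : Set (Fin n × Fin n)} {i j : Fin n} {s : ℕ} (h : InA m I i j s) : s ≤ m := by
  rcases h with h | ⟨h, -⟩ <;> omega

lemma hyp_swap (i j : Fin n) (s : ℝ) : hyp n i j s = hyp n j i (-s) := by
  ext x
  simp only [hyp, Set.mem_ofPred_eq]
  constructor <;> intro h <;> linarith

lemma hyp_mem_BmI (hm : 0 < m) {I : Set (Fin n × Fin n)} (hI : IsIdeal n I) {i j : Fin n}
    (hij : i ≠ j) {s : ℕ} : hyp n i j (s : ℝ) ∈ BmI m n I ↔ InA m I i j s := by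
  constructor
  · rintro (⟨a, b, t, hab, h1, h2, h⟩ | ⟨p, hp, h⟩)
    · left
      rcases hyp_eq_hyp hij hab.ne h with ⟨-, -, h⟩ | ⟨-, -, h⟩
      · have : (s : ℤ) = t := by exact_mod_cast h
        omega
      · have : (s : ℤ) = -t := by exact_mod_cast h
        omega
    · rcases hyp_eq_hyp hij (hI.1 p hp) h with ⟨rfl, rfl, h'⟩ | ⟨-, -, h⟩
      · exact Or.inr ⟨by exact_mod_cast h', hp⟩
      · have : (s : ℤ) = -m := by exact_mod_cast h
        omega
  · rintro (h | ⟨rfl, h⟩)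
    · left
      rcases lt_or_gt_of_ne hij with hlt | hlt
      · exact ⟨i, j, s, hlt, by omega, by omega, by simp⟩
      · exact ⟨j, i, -s, hlt, by omega, by omega, by rw [hyp_swap]; simp⟩
    · exact Or.inr ⟨(i, j), h, rfl⟩

lemma exists_nat_of_hyp_mem_BmI {I : Set (Fin n × Fin n)} {H : Set (Fin n → ℝ)}
    (hI : IsIdeal n I) (hH : H ∈ BmI m n I) :
    ∃ (i j : Fin n) (s : ℕ), i ≠ j ∧ (0 < s ∨ j < i) ∧ H = hyp n i j (s : ℝ) := by
  rcases hH with ⟨a, b, t, hab, h1, h2, rfl⟩ | ⟨p, hp, rfl⟩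
  · rcases lt_or_ge 0 t with ht | ht
    · exact ⟨a, b, t.toNat, hab.ne, by omega, by
        rw [show ((t.toNat : ℕ) : ℝ) = t by exact_mod_cast Int.toNat_of_nonneg ht.le]⟩
    · refine ⟨b, a, (-t).toNat, hab.ne', Or.inr hab, ?_⟩
      rw [hyp_swap, show (((-t).toNat : ℕ) : ℝ) = -t by
        exact_mod_cast Int.toNat_of_nonneg (by omega : 0 ≤ -t)]
  · rcases Nat.eq_zero_or_pos m with rfl | hm
    · rcases lt_or_gt_of_ne (hI.1 p hp) with h | h
      · exact ⟨p.2, p.1, 0, h.ne', Or.inr h, by rw [hyp_swap]; simp⟩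
      · exact ⟨p.1, p.2, 0, h.ne', Or.inr h, rfl⟩
    · exact ⟨p.1, p.2, m, hI.1 p hp, Or.inl hm, rfl⟩

lemma BmI_subset_catArr {I : Set (Fin n × Fin n)} (hI : IsIdeal n I) :
    BmI m n I ⊆ catArr m n := by
  rintro H (⟨a, b, t, hab, h1, h2, rfl⟩ | ⟨p, hp, rfl⟩)
  · exact ⟨a, b, t, hab, by omega, by omega, rfl⟩
  · rcases lt_or_gt_of_ne (hI.1 p hp) with h | h
    · exact ⟨p.1, p.2, m, h, by omega, by omega, by simp⟩
    · exact ⟨p.2, p.1, -m, h, by omega, by omega, by rw [hyp_swap]; simp⟩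

lemma isStronglyTransitive_BmI (hm : 0 < m) {I : Set (Fin n × Fin n)} (hI : IsIdeal n I) :
    IsStronglyTransitive n (BmI m n I) := by
  intro i j k hij hjk hik s t hs ht
  rw [hyp_mem_BmI hm hI hij, InA] at hs
  rw [hyp_mem_BmI hm hI hjk, InA] at ht
  rw [← Nat.cast_add, hyp_mem_BmI hm hI hik, InA]
  omega

/-- The points lying on the same side as `x` of every hyperplane of `A`. -/
def signClass (A : Set (Set (Fin n → ℝ))) (x : Fin n → ℝ) : Set (Fin n → ℝ) :=
  {y | ∀ (i j : Fin n) (s : ℝ), i ≠ j → hyp n i j s ∈ A →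
    SignType.sign (y i - y j - s) = SignType.sign (x i - x j - s)}

lemma IsFace.eq_signClass {A : Set (Set (Fin n → ℝ))}
    (hA : ∀ H ∈ A, ∃ (i j : Fin n) (s : ℝ), i ≠ j ∧ H = hyp n i j s) {F : Set (Fin n → ℝ)}
    (hF : IsFace n A F) {x : Fin n → ℝ} (hx : x ∈ F) : F = signClass A x := by
  obtain ⟨-, σ, hσ, rfl⟩ := hF
  rw [Set.mem_iInter₂] at hx
  ext y
  rw [Set.mem_iInter₂]
  constructor
  · intro hy i j s hij hH
    have hxH := hx _ hH
    have hyH := hy _ hH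
    rcases hσ _ hH with h | ⟨i', j', s', hij', hh, h⟩
    · rw [h] at hxH hyH
      have h1 : x i - x j = s := hxH
      have h2 : y i - y j = s := hyH
      simp [h1, h2]
    · rcases hyp_eq_hyp hij hij' hh with ⟨rfl, rfl, rfl⟩ | ⟨rfl, rfl, rfl⟩ <;>
      rcases h with h | h <;>
      · rw [h] at hxH hyH
        simp only [Set.mem_ofPred_eq] at hxH hyH
        first
        | rw [sign_neg (by linarith), sign_neg (by linarith)]
        | rw [sign_pos (by linarith), sign_pos (by linarith)]
  · intro hy H hH
    have hxH := hx _ hH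
    rcases hσ _ hH with h | ⟨i, j, s, hij, rfl, h⟩
    · rw [h] at hxH ⊢
      obtain ⟨i, j, s, hij, rfl⟩ := hA H hH
      have h1 : x i - x j = s := hxH
      have := hy i j s hij hH
      rw [h1, sub_self, sign_zero, sign_eq_zero_iff] at this
      exact sub_eq_zero.1 this
    · have := hy i j s hij hH
      rcases h with h | h <;> rw [h] at hxH ⊢ <;> simp only [Set.mem_ofPred_eq] at hxH ⊢
      · rw [sign_neg (sub_neg.2 hxH), sign_eq_neg_one_iff] at this
        linarith
      · rw [sign_pos (sub_pos.2 hxH), sign_eq_one_iff] at this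
        linarith

lemma isFace_signClass {A : Set (Set (Fin n → ℝ))}
    (hA : ∀ H ∈ A, ∃ (i j : Fin n) (s : ℝ), i ≠ j ∧ H = hyp n i j s) (x : Fin n → ℝ) :
    IsFace n A (signClass A x) := by
  refine ⟨⟨x, fun _ _ _ _ _ => rfl⟩, fun H => {y | ∀ (i j : Fin n) (s : ℝ), i ≠ j →
    H = hyp n i j s → SignType.sign (y i - y j - s) = SignType.sign (x i - x j - s)}, ?_, ?_⟩
  · intro H hH
    obtain ⟨i, j, s, hij, rfl⟩ := hA H hH
    have key : ∀ y : Fin n → ℝ, (∀ (i' j' : Fin n) (s' : ℝ), i' ≠ j' →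
        hyp n i j s = hyp n i' j' s' →
          SignType.sign (y i' - y j' - s') = SignType.sign (x i' - x j' - s')) ↔
        SignType.sign (y i - y j - s) = SignType.sign (x i - x j - s) := by
      refine fun y => ⟨fun h => h i j s hij rfl, fun h i' j' s' hij' hh => ?_⟩
      rcases hyp_eq_hyp hij hij' hh with ⟨rfl, rfl, rfl⟩ | ⟨rfl, rfl, rfl⟩
      · exact h
      · rw [show y j - y i - s' = -(y i - y j - -s') by ring, Left.sign_neg, h,
          show x j - x i - s' = -(x i - x j - -s') by ring, Left.sign_neg]
    simp only [key]
    rcases lt_trichotomy (x i - x j - s) 0 with h | h | h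
    · refine Or.inr ⟨i, j, s, hij, rfl, Or.inl ?_⟩
      ext y
      simp [sign_neg h, sign_eq_neg_one_iff]
    · left
      ext y
      simp [h, sign_eq_zero_iff, hyp, sub_eq_zero]
    · refine Or.inr ⟨i, j, s, hij, rfl, Or.inr ?_⟩
      ext y
      simp [sign_pos h, sign_eq_one_iff]
  · ext y
    rw [Set.mem_iInter₂]
    constructor
    · rintro hy H hH i j s hij rfl
      exact hy i j s hij hH
    · intro hy i j s hij hH
      exact hy _ hH i j s hij rfl

end Braid

namespace Braid

variable {m n : ℕ}

namespace Tree

lemma IsChild.unique {T : Tree m n} {i j j' : Fin n} {s s' : ℕ} (h : T.IsChild i j s)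
    (h' : T.IsChild i j' s') : j = j' ∧ s = s' := by
  obtain ⟨h1, h2⟩ := List.append_inj' (h.symm.trans h') rfl
  exact ⟨T.inj h1, by simpa using h2⟩

lemma IsChild.drift_eq {T : Tree m n} {i j : Fin n} {s : ℕ} (h : T.IsChild i j s) :
    T.drift i = T.drift j + s := by
  simp only [drift, show T.path i = T.path j ++ [s] from h, List.sum_append, List.sum_singleton]

lemma IsChild.le {T : Tree m n} {i j : Fin n} {s : ℕ} (h : T.IsChild i j s) : s ≤ m :=
  T.entry_le i s (by rw [show T.path i = T.path j ++ [s] from h]; simp)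

lemma IsChild.length {T : Tree m n} {i j : Fin n} {s : ℕ} (h : T.IsChild i j s) :
    (T.path i).length = (T.path j).length + 1 := by
  rw [show T.path i = T.path j ++ [s] from h]; simp

lemma IsChild.ne {T : Tree m n} {i j : Fin n} {s : ℕ} (h : T.IsChild i j s) : i ≠ j := by
  rintro rfl
  have := h.length
  omega

lemma IsCadet.unique {T : Tree m n} {i i' j : Fin n} {s s' : ℕ} (h : T.IsCadet i j s)
    (h' : T.IsCadet i' j s') : i = i' := by
  have hs : s = s' := by
    rcases lt_trichotomy s s' with hlt | rfl | hlt
    · exact absurd ⟨i', h'.1⟩ (h.2 s' hlt h'.1.le)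
    · rfl
    · exact absurd ⟨i, h.1⟩ (h'.2 s hlt h.1.le)
  subst hs
  exact T.inj (h.1.trans h'.1.symm)

lemma exists_isChild {T : Tree m n} {i : Fin n} (h : T.path i ≠ []) :
    ∃ j s, T.IsChild i j s := by
  obtain ⟨j, hj⟩ := T.parent_closed i h
  exact ⟨j, (T.path i).getLast h, by rw [IsChild, hj, List.dropLast_append_getLast]⟩

lemma exists_path_eq {T : Tree m n} {p : List ℕ} {i : Fin n} (h : p <+: T.path i) :
    ∃ a, T.path a = p := by
  obtain ⟨l, hl⟩ := h
  induction l using List.reverseRecOn generalizing i with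
  | nil => exact ⟨i, by simpa using hl.symm⟩
  | append_singleton l s ih =>
    have hne : T.path i ≠ [] := by rw [← hl]; simp
    obtain ⟨j, t, hj⟩ := exists_isChild hne
    rw [IsChild, ← hl, ← List.append_assoc] at hj
    exact ih (List.append_inj_left' hj rfl)

end Tree

/-- `{i, j}` is a marked edge with `j` the parent of `i`. -/
def Down (T : Tree m n) (μ : Set (Sym2 (Fin n))) (j i : Fin n) : Prop :=
  s(i, j) ∈ μ ∧ ∃ s, T.IsCadet i j s

variable {T : Tree m n} {μ : Set (Sym2 (Fin n))}

lemma IsMarking.down_or_down (hμ : IsMarking T μ) {a b : Fin n} (h : s(a, b) ∈ μ) :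
    Down T μ a b ∨ Down T μ b a := by
  obtain ⟨i, j, s, he, hc⟩ := hμ.1 _ h
  rcases Sym2.eq_iff.1 he with ⟨rfl, rfl⟩ | ⟨rfl, rfl⟩
  · exact Or.inr ⟨h, s, hc⟩
  · exact Or.inl ⟨Sym2.eq_swap ▸ h, s, hc⟩

lemma IsMarking.down_of_isChild (hμ : IsMarking T μ) {i j : Fin n} {s : ℕ}
    (h : s(i, j) ∈ μ) (hc : T.IsChild i j s) : T.IsCadet i j s := by
  rcases hμ.down_or_down h with ⟨-, t, ht⟩ | ⟨-, t, ht⟩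
  · have := ht.1.length
    have := hc.length
    omega
  · rwa [(hc.unique ht.1).2]

lemma Down.right_unique {j i i' : Fin n} (h : Down T μ j i) (h' : Down T μ j i') : i = i' := by
  obtain ⟨-, s, hs⟩ := h
  obtain ⟨-, s', hs'⟩ := h'
  exact hs.unique hs'

lemma Down.left_unique {j j' i : Fin n} (h : Down T μ j i) (h' : Down T μ j' i) : j = j' := by
  obtain ⟨-, s, hs⟩ := h
  obtain ⟨-, s', hs'⟩ := h'
  exact (hs.1.unique hs'.1).1

open Relation in
lemma IsMarking.chain_of_simMu (hμ : IsMarking T μ) {a b : Fin n} (h : simMu μ a b) :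
    ReflTransGen (Down T μ) a b ∨ ReflTransGen (Down T μ) b a := by
  induction h with
  | refl => exact Or.inl .refl
  | tail _ hbc ih =>
    rcases hμ.down_or_down hbc with hd | hd
    · rcases ih with ih | ih
      · exact Or.inl (ih.tail hd)
      · rcases ih.cases_head with rfl | ⟨e, he, ih⟩
        · exact Or.inl (.single hd)
        · rw [hd.right_unique he]
          exact Or.inr ih
    · rcases ih with ih | ih
      · rcases ih.cases_tail with rfl | ⟨e, ih, he⟩
        · exact Or.inr (.single hd)
        · rw [hd.left_unique he]
          exact Or.inl ih
      · exact Or.inr (.head hd ih)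

lemma IsMarking.of_chain (hμ : IsMarking T μ) {j i : Fin n}
    (h : Relation.ReflTransGen (Down T μ) j i) :
    T.path j <+: T.path i ∧ T.drift j ≤ T.drift i ∧ (T.drift j = T.drift i → j ≤ i) := by
  induction h with
  | refl => simp
  | tail _ hbc ih =>
    obtain ⟨hmem, s, hs⟩ := hbc
    have hd := hs.1.drift_eq
    refine ⟨ih.1.trans ⟨[s], hs.1.symm⟩, by omega, fun he => ?_⟩
    have h0 : s = 0 := by omega
    subst h0
    exact (ih.2.2 (by omega)).trans (hμ.2 _ _ hmem hs).le

lemma simMu_symm {a b : Fin n} (h : simMu μ a b) : simMu μ b a :=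
  haveI : Std.Symm (fun a b => s(a, b) ∈ μ) := ⟨fun _ _ h => Sym2.eq_swap ▸ h⟩
  Relation.ReflTransGen.stdSymm.symm _ _ h

lemma IsMarking.mem_of_simMu (hμ : IsMarking T μ) {i j : Fin n} {s : ℕ} (hc : T.IsChild i j s)
    (h : simMu μ i j) : s(i, j) ∈ μ := by
  rcases hμ.chain_of_simMu h with h | h
  · have := (hμ.of_chain h).1.length_le
    have := hc.length
    omega
  · rcases h.cases_tail with rfl | ⟨e, -, he⟩
    · exact absurd rfl hc.ne
    · obtain ⟨hmem, t, ht⟩ := he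
      rwa [(hc.unique ht.1).1]

lemma mem_ideal_of_chain (hm : 0 < m) {I : Set (Fin n × Fin n)} (hI : IsIdeal n I)
    (hμ : IsMarking T μ) {i j a b : Fin n} (hc : T.IsChild i j m)
    (ha : Relation.ReflTransGen (Down T μ) i a) (hb : Relation.ReflTransGen (Down T μ) b j)
    (h : hyp n a b ((T.drift a : ℝ) - (T.drift b : ℝ)) ∈ BmI m n I) : (i, j) ∈ I := by
  obtain ⟨-, ha1, ha2⟩ := hμ.of_chain ha
  obtain ⟨-, hb1, hb2⟩ := hμ.of_chain hb
  have hd := hc.drift_eq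
  have hab : a ≠ b := by rintro rfl; omega
  rw [← Nat.cast_sub (by omega), hyp_mem_BmI hm hI hab] at h
  rcases h with h | ⟨h, hI'⟩
  · omega
  · exact hI.2 _ hI' (i, j) hc.ne (ha2 (by omega)) (hb2 (by omega))

lemma AConnected.mem_ideal (hm : 0 < m) {I : Set (Fin n × Fin n)} (hI : IsIdeal n I)
    (hμ : IsMarking T μ) (hA : AConnected (BmI m n I) T μ) (hC : CadetCond (BmI m n I) T μ)
    {i j : Fin n} (hc : T.IsChild i j m) : (i, j) ∈ I := by
  by_cases hmem : s(i, j) ∈ μ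
  · have hconn : BlockConnected (BmI m n I) T (blockOf μ i) := hA i
    have hji : simMu μ i j := .single hmem
    obtain ⟨w⟩ := hconn.preconnected ⟨i, .refl⟩ ⟨j, hji⟩
    obtain ⟨d, -, hd1, hd2⟩ := w.exists_boundary_dart {v | T.path i <+: T.path v.1}
      (by simp) (fun h => by
        have : (T.path i).length ≤ (T.path j).length := List.IsPrefix.length_le h
        have := hc.length
        omega)
    have hadj := d.adj
    generalize d.fst = a at hd1 hadj
    generalize d.snd = b at hd2 hadj
    obtain ⟨a, ha⟩ := a
    obtain ⟨b, hb⟩ := b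
    simp only [Set.mem_ofPred_eq] at hd1 hd2
    have hia : Relation.ReflTransGen (Down T μ) i a := by
      rcases hμ.chain_of_simMu ha with h | h
      · exact h
      · have h1 := (hμ.of_chain h).1
        rw [T.inj (h1.eq_of_length_le hd1.length_le)]
    have hbj : Relation.ReflTransGen (Down T μ) b j := by
      rcases hμ.chain_of_simMu hb with h | h
      · exact absurd (hμ.of_chain h).1 hd2
      · rcases h.cases_tail with rfl | ⟨e, he, he'⟩
        · exact absurd (List.prefix_refl _) hd2
        · obtain ⟨-, t, ht⟩ := he'
          rwa [(hc.unique ht.1).1]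
    refine mem_ideal_of_chain hm hI hμ hc hia hbj ?_
    rcases ((SimpleGraph.fromRel_adj _ _ _).1 hadj).2 with h | h
    · exact h
    · rw [hyp_swap]
      simpa using h
  · have hcad : T.IsCadet i j m := ⟨hc, fun t h1 h2 => by omega⟩
    rcases hC i j m hcad hmem with ⟨h, -⟩ | ⟨i', j', hi, hj, h⟩
    · omega
    · refine mem_ideal_of_chain hm hI hμ hc ?_ ?_ h
      · rcases hμ.chain_of_simMu hi with h | h
        · rcases h.cases_tail with rfl | ⟨e, he, hmem', t, ht⟩
          · exact .refl
          · rw [← (hc.unique ht.1).1] at hmem'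
            exact absurd hmem' hmem
        · exact h
      · rcases hμ.chain_of_simMu hj with h | h
        · exact h
        · rcases h.cases_head with rfl | ⟨e, ⟨hmem', t, ht⟩, he⟩
          · exact .refl
          · rw [ht.unique hcad] at hmem'
            exact absurd hmem' hmem

lemma inA_of_isChild {I : Set (Fin n × Fin n)}
    (hT : ∀ i j : Fin n, T.IsChild i j m → (i, j) ∈ I) {i j : Fin n} {s : ℕ}
    (hc : T.IsChild i j s) : InA m I i j s := by
  rcases hc.le.lt_or_eq with h | rfl
  · exact Or.inl h
  · exact Or.inr ⟨rfl, hT _ _ hc⟩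

theorem OTset_BmI (hm : 0 < m) {I : Set (Fin n × Fin n)} (hI : IsIdeal n I) :
    OTset m n (BmI m n I) =
      {p ∈ OTall m n | ∀ i j : Fin n, p.1.IsChild i j m → (i, j) ∈ I} := by
  ext ⟨T, μ⟩
  constructor
  · rintro ⟨hμ, hA, hC⟩
    exact ⟨hμ, fun i j hc => hA.mem_ideal hm hI hμ hC hc⟩
  · rintro ⟨hμ, hT⟩
    have hedge : ∀ {i j : Fin n} {s : ℕ}, T.IsChild i j s →
        hyp n i j ((T.drift i : ℝ) - (T.drift j : ℝ)) ∈ BmI m n I := fun {i j s} hc => by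
      have := (hyp_mem_BmI hm hI hc.ne).2 (inA_of_isChild hT hc)
      simpa [hc.drift_eq] using this
    refine ⟨hμ, fun i => ?_, fun i j s hc hmem => Or.inr ⟨i, j, .refl, .refl, hedge hc.1⟩⟩
    have hreach : ∀ a (ha : simMu μ i a), (SimpleGraph.fromRel (fun a b : blockOf μ i =>
        hyp n a b ((T.drift a : ℝ) - (T.drift b : ℝ)) ∈ BmI m n I)).Reachable
          ⟨i, .refl⟩ ⟨a, ha⟩ := by
      intro a ha
      induction ha with
      | refl => exact .refl _
      | @tail b c hb hbc ih =>
        refine ih.trans (SimpleGraph.Adj.reachable ?_)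
        rw [SimpleGraph.fromRel_adj]
        rcases hμ.down_or_down hbc with ⟨-, s, hs⟩ | ⟨-, s, hs⟩
        · exact ⟨fun h => hs.1.ne (congrArg Subtype.val h).symm, Or.inr (hedge hs.1)⟩
        · exact ⟨fun h => hs.1.ne (congrArg Subtype.val h), Or.inl (hedge hs.1)⟩
    have : Nonempty (blockOf μ i) := ⟨⟨i, .refl⟩⟩
    exact ⟨fun a b => (hreach a.1 a.2).symm.trans (hreach b.1 b.2)⟩

end Braid

namespace Braid

variable {m n : ℕ} {T : Tree m n} {μ : Set (Sym2 (Fin n))} {I : Set (Fin n × Fin n)}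

lemma sub_eq_drift_sub (hμ : IsMarking T μ) {x : Fin n → ℝ}
    (hx : ∀ (i j : Fin n) (s : ℕ), s(i, j) ∈ μ → T.IsChild i j s → x i - x j = (s : ℝ))
    {i j : Fin n} (h : simMu μ i j) : x i - x j = (T.drift i : ℝ) - T.drift j := by
  induction h with
  | refl => simp
  | @tail b c _ hbc ih =>
    rcases hμ.down_or_down hbc with ⟨hmem, s, hs⟩ | ⟨hmem, s, hs⟩
    · have h1 := hx _ _ _ hmem hs.1
      have h2 : (T.drift c : ℝ) = T.drift b + s := by exact_mod_cast hs.1.drift_eq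
      linarith
    · have h1 := hx _ _ _ hmem hs.1
      have h2 : (T.drift b : ℝ) = T.drift c + s := by exact_mod_cast hs.1.drift_eq
      linarith

lemma vkey_child_le_of_simMu (hμ : IsMarking T μ) {i j : Fin n} {s : ℕ} (h : simMu μ i j)
    (hij : i ≠ j) (hd : T.drift i = T.drift j + s) (hs : 0 < s ∨ j < i) :
    vkey (T.path j ++ [s]) ≤ vkey (T.path i) := by
  rcases hμ.chain_of_simMu h with h | h
  · obtain ⟨-, h1, h2⟩ := hμ.of_chain h
    have := h2 (by omega)
    omega
  · obtain ⟨⟨l, hl⟩, -, -⟩ := hμ.of_chain h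
    have hl0 : l ≠ [] := by
      rintro rfl
      exact hij (T.inj (by simpa using hl.symm))
    have hsum : l.sum = s := by
      simp only [Tree.drift, ← hl, List.sum_append] at hd
      omega
    rw [← hl, ← hsum]
    exact vkey_append_sum_le _ hl0

lemma PhiBar.child_le_iff (hμ : IsMarking T μ) {A : Set (Set (Fin n → ℝ))} {x : Fin n → ℝ}
    (hx : x ∈ PhiBar m n A T μ) {i j : Fin n} {s : ℕ} (h : TrIdxA m n A i j s) :
    vkey (T.path j ++ [s]) ≤ vkey (T.path i) ↔ (s : ℝ) ≤ x i - x j := by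
  by_cases hsim : simMu μ i j
  · rw [sub_eq_drift_sub hμ hx.1 hsim]
    constructor
    · intro hle
      have : T.drift j + s ≤ T.drift i := by
        rw [vkey_le] at hle
        simp only [List.sum_append, List.sum_singleton] at hle
        simp only [Tree.drift]
        omega
      have : (T.drift j : ℝ) + s ≤ T.drift i := by exact_mod_cast this
      linarith
    · intro hle
      have : (T.drift j : ℝ) + s ≤ T.drift i := by linarith
      have : T.drift j + s ≤ T.drift i := by exact_mod_cast this
      rcases this.lt_or_eq with hlt | heq
      · rw [vkey_le]
        left
        simpa [Tree.drift] using hlt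
      · exact vkey_child_le_of_simMu hμ hsim h.1.2.1 heq.symm h.1.2.2
  · obtain ⟨h1, h2⟩ := hx.2 i j s h hsim
    rw [vlt_iff] at h1
    rw [vge_iff] at h2
    constructor
    · exact fun hle => (h2 hle).le
    · intro hle
      by_contra hlt
      exact absurd (h1 (not_le.1 hlt)) (not_lt.2 hle)

lemma PhiBar.simMu_of_eq {A : Set (Set (Fin n → ℝ))} {x : Fin n → ℝ}
    (hx : x ∈ PhiBar m n A T μ) {i j : Fin n} {s : ℕ} (h : TrIdxA m n A i j s)
    (he : x i - x j = s) : simMu μ i j := by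
  by_contra hsim
  obtain ⟨h1, h2⟩ := hx.2 i j s h hsim
  rw [vlt_iff] at h1
  rw [vge_iff] at h2
  rcases lt_or_ge (vkey (T.path i)) (vkey (T.path j ++ [s])) with hlt | hle
  · exact (h1 hlt).ne he
  · exact (h2 hle).ne' he

lemma trIdxA_BmI (hm : 0 < m) (hI : IsIdeal n I) {i j : Fin n} {s : ℕ} :
    TrIdxA m n (BmI m n I) i j s ↔ i ≠ j ∧ (0 < s ∨ j < i) ∧ InA m I i j s := by
  constructor
  · rintro ⟨⟨-, h1, h2⟩, h⟩
    exact ⟨h1, h2, (hyp_mem_BmI hm hI h1).1 h⟩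
  · rintro ⟨h1, h2, h⟩
    exact ⟨⟨h.le, h1, h2⟩, (hyp_mem_BmI hm hI h1).2 h⟩

/-- The comparisons of nodes and children read off from a point of `Φ̄_A(T,μ)`. -/
lemma PhiBar.child_le_iff_of_inA (hm : 0 < m) (hI : IsIdeal n I) (hμ : IsMarking T μ)
    {x : Fin n → ℝ} (hx : x ∈ PhiBar m n (BmI m n I) T μ) {i j : Fin n} {s : ℕ} (hij : i ≠ j)
    (h : InA m I i j s) : vkey (T.path j ++ [s]) ≤ vkey (T.path i) ↔
      (s : ℝ) < x i - x j ∨ (s : ℝ) = x i - x j ∧ (0 < s ∨ j < i) := by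
  by_cases hs : 0 < s ∨ j < i
  · rw [child_le_iff hμ hx ((trIdxA_BmI hm hI).2 ⟨hij, hs, h⟩), le_iff_lt_or_eq]
    simp [hs]
  · have h0 : s = 0 := by omega
    subst h0
    have hlt : i < j := by omega
    have := child_le_iff hμ hx ((trIdxA_BmI hm hI).2 ⟨hij.symm, Or.inr hlt, Or.inl hm⟩)
    have hne : T.path j ≠ T.path i := fun e => hij (T.inj e).symm
    have hne' : T.path i ≠ T.path j := hne.symm
    have h1 : ∀ {a b : List ℕ}, a ≠ b → (vkey (b ++ [0]) ≤ vkey a ↔ vkey b < vkey a) := by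
      intro a b hab
      refine ⟨fun h => (vkey_lt_append b (by simp)).trans_le h, fun h => ?_⟩
      by_contra hcon
      rw [not_le, vkey_lt] at hcon
      rw [vkey_lt] at h
      simp only [List.sum_append, List.sum_singleton, add_zero] at hcon
      rcases hcon with hcon | ⟨he, hcon⟩
      · omega
      · have := (pre_lt_of_lt_append_singleton hcon hab (by omega)).1
        rcases h with h | ⟨-, h⟩
        · omega
        · exact lt_asymm h this
    rw [h1 hne] at this
    rw [h1 hne', ← not_le, le_iff_lt_or_eq, vkey_injective.eq_iff, this]
    simp only [Nat.cast_zero, hne', or_false, sub_nonneg, not_le, sub_pos, hs, and_false]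

/-- The node order read off from a point determines the tree. -/
lemma PhiBar.path_eq (hm : 0 < m) (hI : IsIdeal n I) {T' : Tree m n} {μ' : Set (Sym2 (Fin n))}
    (hμ : IsMarking T μ) (hμ' : IsMarking T' μ')
    (hT : ∀ i j : Fin n, T.IsChild i j m → (i, j) ∈ I)
    (hT' : ∀ i j : Fin n, T'.IsChild i j m → (i, j) ∈ I) {x : Fin n → ℝ}
    (hx : x ∈ PhiBar m n (BmI m n I) T μ) (hx' : x ∈ PhiBar m n (BmI m n I) T' μ') (i : Fin n) :
    T.path i = T'.path i := by
  have hord : ∀ {i j : Fin n} {s : ℕ}, i ≠ j → InA m I i j s →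
      (vkey (T.path j ++ [s]) ≤ vkey (T.path i) ↔
        vkey (T'.path j ++ [s]) ≤ vkey (T'.path i)) := fun hij h => by
    rw [child_le_iff_of_inA hm hI hμ hx hij h, child_le_iff_of_inA hm hI hμ' hx' hij h]
  have hwf : WellFounded (fun a b : Fin n => vkey (T.path a) < vkey (T.path b)) :=
    haveI : IsTrans (Fin n) (fun a b : Fin n => vkey (T.path a) < vkey (T.path b)) :=
      ⟨fun _ _ _ => lt_trans⟩
    haveI : Std.Irrefl (fun a b : Fin n => vkey (T.path a) < vkey (T.path b)) :=
      ⟨fun _ => lt_irrefl _⟩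
    Finite.wellFounded_of_trans_of_irrefl _
  induction i using hwf.induction with
  | _ i ih =>
  have hchild : ∀ {j s}, T.IsChild i j s → vkey (T.path j) < vkey (T.path i) := fun {j s} h => by
    rw [show T.path i = _ from h]
    exact vkey_lt_append _ (by simp)
  have hchild' : ∀ {j s}, T'.IsChild i j s → T.path j = T'.path j := fun {j s} h => by
    apply ih
    have h1 : vkey (T'.path j ++ [0]) ≤ vkey (T'.path i) := by
      rw [show T'.path i = _ from h, vkey_append_singleton_le]
      exact Nat.zero_le _
    rw [← hord h.ne (Or.inl hm)] at h1
    exact (vkey_lt_append _ (by simp)).trans_le h1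
  apply vkey_injective
  apply le_antisymm
  · by_cases h : T.path i = []
    · by_cases h' : T'.path i = []
      · rw [h, h']
      · rw [h]
        exact (vkey_nil_lt h').le
    · obtain ⟨j, s, hc⟩ := Tree.exists_isChild h
      have := (hord hc.ne (inA_of_isChild hT hc)).1 (by rw [show T.path i = _ from hc])
      rwa [← ih j (hchild hc), ← show T.path i = _ from hc] at this
  · by_cases h : T'.path i = []
    · by_cases h' : T.path i = []
      · rw [h, h']
      · rw [h]
        exact (vkey_nil_lt h').le
    · obtain ⟨j, s, hc⟩ := Tree.exists_isChild h
      have := (hord hc.ne (inA_of_isChild hT' hc)).2 (by rw [show T'.path i = _ from hc])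
      rwa [hchild' hc, ← show T'.path i = _ from hc] at this

lemma Tree.ext_path {T T' : Tree m n} (h : T.path = T'.path) : T = T' := by
  cases T
  cases T'
  cases h
  rfl

lemma PhiBar.mem_iff_of_isChild (hm : 0 < m) (hI : IsIdeal n I) (hμ : IsMarking T μ)
    (hT : ∀ i j : Fin n, T.IsChild i j m → (i, j) ∈ I) {x : Fin n → ℝ}
    (hx : x ∈ PhiBar m n (BmI m n I) T μ) {i j : Fin n} {s : ℕ} (hc : T.IsChild i j s) :
    s(i, j) ∈ μ ↔ x i - x j = s := by
  refine ⟨fun h => hx.1 i j s h hc, fun h => hμ.mem_of_simMu hc ?_⟩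
  have hA := inA_of_isChild hT hc
  by_cases hs : 0 < s ∨ j < i
  · exact simMu_of_eq hx ((trIdxA_BmI hm hI).2 ⟨hc.ne, hs, hA⟩) h
  · have h0 : s = 0 := by omega
    subst h0
    have hlt : i < j := lt_of_le_of_ne (by omega) hc.ne
    exact simMu_symm (simMu_of_eq hx
      ((trIdxA_BmI hm hI).2 ⟨hc.ne.symm, Or.inr hlt, Or.inl hm⟩) (by push_cast at h ⊢; linarith))

theorem PhiBar.unique (hm : 0 < m) (hI : IsIdeal n I) {T' : Tree m n} {μ' : Set (Sym2 (Fin n))}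
    (hμ : IsMarking T μ) (hμ' : IsMarking T' μ')
    (hT : ∀ i j : Fin n, T.IsChild i j m → (i, j) ∈ I)
    (hT' : ∀ i j : Fin n, T'.IsChild i j m → (i, j) ∈ I) {x : Fin n → ℝ}
    (hx : x ∈ PhiBar m n (BmI m n I) T μ) (hx' : x ∈ PhiBar m n (BmI m n I) T' μ') :
    T = T' ∧ μ = μ' := by
  have hTT : T = T' := Tree.ext_path (funext (path_eq hm hI hμ hμ' hT hT' hx hx'))
  subst hTT
  refine ⟨rfl, Set.Subset.antisymm (fun e he => ?_) (fun e he => ?_)⟩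
  · obtain ⟨i, j, s, rfl, hc⟩ := hμ.1 e he
    rwa [mem_iff_of_isChild hm hI hμ' hT hx' hc.1, ← mem_iff_of_isChild hm hI hμ hT hx hc.1]
  · obtain ⟨i, j, s, rfl, hc⟩ := hμ'.1 e he
    rwa [mem_iff_of_isChild hm hI hμ hT hx hc.1, ← mem_iff_of_isChild hm hI hμ' hT hx' hc.1]

lemma PhiBar.eq_signClass (hm : 0 < m) (hI : IsIdeal n I) (hμ : IsMarking T μ)
    (hT : ∀ i j : Fin n, T.IsChild i j m → (i, j) ∈ I) {x : Fin n → ℝ}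
    (hx : x ∈ PhiBar m n (BmI m n I) T μ) :
    PhiBar m n (BmI m n I) T μ = signClass (BmI m n I) x := by
  ext y
  constructor
  · intro hy i j r hij hH
    obtain ⟨a, b, s, hab, hs, he⟩ := exists_nat_of_hyp_mem_BmI hI hH
    have hA : TrIdxA m n (BmI m n I) a b s := by
      rw [he, hyp_mem_BmI hm hI hab] at hH
      exact (trIdxA_BmI hm hI).2 ⟨hab, hs, hH⟩
    have key : SignType.sign (y a - y b - s) = SignType.sign (x a - x b - s) := by
      by_cases hsim : simMu μ a b
      · rw [sub_eq_drift_sub hμ hx.1 hsim, sub_eq_drift_sub hμ hy.1 hsim]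
      · obtain ⟨h1, h2⟩ := hx.2 a b s hA hsim
        obtain ⟨h1', h2'⟩ := hy.2 a b s hA hsim
        rw [vlt_iff] at h1 h1'
        rw [vge_iff] at h2 h2'
        rcases lt_or_ge (vkey (T.path a)) (vkey (T.path b ++ [s])) with hlt | hle
        · rw [sign_neg (sub_neg.2 (h1 hlt)), sign_neg (sub_neg.2 (h1' hlt))]
        · rw [sign_pos (sub_pos.2 (h2 hle)), sign_pos (sub_pos.2 (h2' hle))]
    rcases hyp_eq_hyp hij hab he with ⟨rfl, rfl, rfl⟩ | ⟨rfl, rfl, rfl⟩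
    · exact key
    · rw [show y i - y j - -(s : ℝ) = -(y j - y i - s) by ring, Left.sign_neg, key,
        show x i - x j - -(s : ℝ) = -(x j - x i - s) by ring, Left.sign_neg]
  · intro hy
    refine ⟨fun i j s hmem hc => ?_, fun i j s h hsim => ?_⟩
    · have := hy i j s hc.ne ((hyp_mem_BmI hm hI hc.ne).2 (inA_of_isChild hT hc))
      rw [hx.1 i j s hmem hc, sub_self, sign_zero, sign_eq_zero_iff] at this
      linarith
    · have hsign := hy i j s h.1.2.1 h.2
      obtain ⟨h1, h2⟩ := hx.2 i j s h hsim
      constructor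
      · intro hlt
        rw [sign_neg (sub_neg.2 (h1 hlt)), sign_eq_neg_one_iff] at hsign
        linarith
      · intro hle
        rw [sign_pos (sub_pos.2 (h2 hle)), sign_eq_one_iff] at hsign
        linarith

end Braid

namespace Braid

variable {m n : ℕ} {T : Tree m n} {μ : Set (Sym2 (Fin n))} {I : Set (Fin n × Fin n)}

/-- The nodes that are the lower end of a marked edge. -/
def markedBelow (T : Tree m n) (μ : Set (Sym2 (Fin n))) : Set (Fin n) := {i | ∃ j, Down T μ j i}

open Classical in
/-- The number of block tops visited before or at `i` in the traversal. -/
noncomputable def blockRank (T : Tree m n) (μ : Set (Sym2 (Fin n))) (i : Fin n) : ℕ :=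
  (Finset.univ.filter fun a => a ∉ markedBelow T μ ∧ pre (T.path a) ≤ pre (T.path i)).card

lemma blockRank_le (i : Fin n) : blockRank T μ i ≤ n :=
  (Finset.card_le_univ _).trans (by simp)

lemma pre_le_of_isCadet {i j a : Fin n} {s : ℕ} (hc : T.IsCadet i j s) (hai : a ≠ i) :
    pre (T.path a) ≤ pre (T.path i) ↔ pre (T.path a) ≤ pre (T.path j) := by
  have hji : pre (T.path j) < pre (T.path i) := by
    rw [show T.path i = _ from hc.1]
    exact pre_lt_append _ (by simp)
  refine ⟨fun h => ?_, fun h => h.trans hji.le⟩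
  by_contra hlt
  have hlt' : pre (T.path a) < pre (T.path i) :=
    lt_of_le_of_ne h fun e => hai (T.inj (pre_injective e))
  rw [show T.path i = _ from hc.1] at hlt'
  obtain ⟨u, hu, hp⟩ := exists_prefix_of_pre_between (not_le.1 hlt) hlt'
  obtain ⟨b, hb⟩ := Tree.exists_path_eq hp
  exact hc.2 u hu (Tree.IsChild.le (i := b) (j := j) hb) ⟨b, hb⟩

lemma blockRank_eq_of_down {i j : Fin n} (h : Down T μ j i) :
    blockRank T μ i = blockRank T μ j := by
  classical
  unfold blockRank
  congr 1
  ext a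
  simp only [Finset.mem_filter, Finset.mem_univ, true_and]
  refine and_congr_right fun ha => ?_
  obtain ⟨s, hs⟩ := h.2
  exact pre_le_of_isCadet hs fun e => ha (e ▸ ⟨j, h⟩)

lemma blockRank_lt {i j : Fin n} (h : pre (T.path i) < pre (T.path j))
    (hsim : ¬ simMu μ i j) : blockRank T μ i < blockRank T μ j := by
  classical
  induction hl : (T.path j).length generalizing j with
  | zero =>
    rw [List.length_eq_zero_iff.1 hl] at h
    simp at h
  | succ l ih =>
    by_cases hj : j ∈ markedBelow T μ
    · obtain ⟨k, hk⟩ := hj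
      rw [blockRank_eq_of_down hk]
      obtain ⟨hmem, s, hs⟩ := hk
      have hik : ¬ simMu μ i k := fun hik => hsim (hik.tail (Sym2.eq_swap ▸ hmem))
      have hlen := hs.1.length
      refine ih (lt_of_le_of_ne ?_ ?_) hik (by omega)
      · exact (pre_le_of_isCadet hs (by rintro rfl; exact lt_irrefl _ h)).1 h.le
      · intro e
        rw [T.inj (pre_injective e)] at hik
        exact hik .refl
    · apply Finset.card_lt_card
      rw [Finset.ssubset_iff_of_subset]
      · exact ⟨j, by simp [hj], by simp [h]⟩
      · intro a
        simp only [Finset.mem_filter, Finset.mem_univ, true_and]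
        exact fun ha => ⟨ha.1, ha.2.trans h.le⟩

theorem PhiBar.nonempty (hμ : IsMarking T μ) (A : Set (Set (Fin n → ℝ))) :
    (PhiBar m n A T μ).Nonempty := by
  have hn : (0 : ℝ) < n + 1 := by positivity
  refine ⟨fun i => T.drift i + blockRank T μ i / (n + 1), fun i j s hmem hc => ?_,
    fun i j s h hsim => ?_⟩
  · have hd := hμ.down_of_isChild hmem hc
    simp only [blockRank_eq_of_down ⟨hmem, s, hd⟩, hc.drift_eq]
    push_cast
    ring
  · have hpath : T.path i ≠ T.path j := fun e => h.1.2.1 (T.inj e)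
    have hbound : ∀ a : Fin n, 0 ≤ (blockRank T μ a : ℝ) / (n + 1) ∧
        (blockRank T μ a : ℝ) / (n + 1) < 1 := fun a => by
      refine ⟨by positivity, (div_lt_one hn).2 ?_⟩
      have := blockRank_le (T := T) (μ := μ) a
      exact_mod_cast Nat.lt_succ_of_le this
    have hi := hbound i
    have hj := hbound j
    simp only [Tree.drift]
    constructor
    · intro hlt
      rw [vlt_iff, vkey_lt] at hlt
      simp only [List.sum_append, List.sum_singleton] at hlt
      rcases hlt with hlt | ⟨he, hlt⟩
      · have : ((T.path i).sum : ℝ) + 1 ≤ (T.path j).sum + s := by exact_mod_cast hlt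
        linarith
      · have hr := blockRank_lt (pre_lt_of_lt_append_singleton hlt hpath he).1 hsim
        have hr' : (blockRank T μ i : ℝ) / (n + 1) < blockRank T μ j / (n + 1) :=
          (div_lt_div_iff_of_pos_right hn).2 (by exact_mod_cast hr)
        have : ((T.path i).sum : ℝ) = (T.path j).sum + s := by exact_mod_cast he
        linarith
    · intro hle
      rw [vge_iff, vkey_le] at hle
      simp only [List.sum_append, List.sum_singleton] at hle
      rcases hle with hlt | ⟨he, hle⟩
      · have : ((T.path j).sum : ℝ) + s + 1 ≤ (T.path i).sum := by exact_mod_cast hlt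
        linarith
      · have hr := blockRank_lt ((pre_lt_append (T.path j) (by simp)).trans_le hle)
          (fun h => hsim (simMu_symm h))
        have hr' : (blockRank T μ j : ℝ) / (n + 1) < blockRank T μ i / (n + 1) :=
          (div_lt_div_iff_of_pos_right hn).2 (by exact_mod_cast hr)
        have : ((T.path j).sum : ℝ) + s = (T.path i).sum := by exact_mod_cast he
        linarith

/-- The vectors that are constant along the marked edges. -/
def blockSpace (T : Tree m n) (μ : Set (Sym2 (Fin n))) : Submodule ℝ (Fin n → ℝ) where
  carrier := {v | ∀ i j, Down T μ j i → v i = v j}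
  add_mem' := fun hv hw i j h => by simp [hv i j h, hw i j h]
  zero_mem' := fun _ _ _ => rfl
  smul_mem' := fun c v hv i j h => by simp [hv i j h]

lemma PhiBar.exists_add_smul_mem (hμ : IsMarking T μ) {A : Set (Set (Fin n → ℝ))}
    {x v : Fin n → ℝ} (hx : x ∈ PhiBar m n A T μ) (hv : v ∈ blockSpace T μ) :
    ∃ ε : ℝ, ε ≠ 0 ∧ x + ε • v ∈ PhiBar m n A T μ := by
  have key : ∀ᶠ ε : ℝ in nhds 0, ∀ i j : Fin n, ∀ s ∈ Set.Iic m,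
      (x i - x j < s → (x + ε • v) i - (x + ε • v) j < s) ∧
      ((s : ℝ) < x i - x j → (s : ℝ) < (x + ε • v) i - (x + ε • v) j) := by
    refine Filter.eventually_all.2 fun i => Filter.eventually_all.2 fun j =>
      (Filter.eventually_all_finite (Set.finite_Iic m)).2 fun s _ => ?_
    have hcont : Filter.Tendsto (fun ε : ℝ => (x + ε • v) i - (x + ε • v) j) (nhds 0)
        (nhds (x i - x j)) := by
      have : Continuous fun ε : ℝ => (x + ε • v) i - (x + ε • v) j := by
        simp only [Pi.add_apply, Pi.smul_apply, smul_eq_mul]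
        fun_prop
      simpa using this.tendsto 0
    refine Filter.Eventually.and ?_ ?_
    · by_cases h : x i - x j < s
      · filter_upwards [hcont.eventually_lt_const h] with ε hε _ using hε
      · exact Filter.Eventually.of_forall fun ε h' => absurd h' h
    · by_cases h : (s : ℝ) < x i - x j
      · filter_upwards [hcont.eventually_const_lt h] with ε hε _ using hε
      · exact Filter.Eventually.of_forall fun ε h' => absurd h' h
  obtain ⟨ε, hε, hpos⟩ := ((key.filter_mono nhdsWithin_le_nhds).and
    (self_mem_nhdsWithin (s := Set.Ioi (0 : ℝ)))).exists
  refine ⟨ε, ne_of_gt hpos, fun i j s hmem hc => ?_, fun i j s h hsim => ?_⟩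
  · have h1 := hx.1 i j s hmem hc
    have h2 := hv i j ⟨hmem, s, hμ.down_of_isChild hmem hc⟩
    simp only [Pi.add_apply, Pi.smul_apply, h2]
    linarith
  · obtain ⟨h1, h2⟩ := hx.2 i j s h hsim
    obtain ⟨h1', h2'⟩ := hε i j s h.1.1
    exact ⟨fun hlt => h1' (h1 hlt), fun hle => h2' (h2 hle)⟩

lemma PhiBar.direction_eq (hμ : IsMarking T μ) (A : Set (Set (Fin n → ℝ))) :
    (affineSpan ℝ (PhiBar m n A T μ)).direction = blockSpace T μ := by
  rw [direction_affineSpan]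
  apply le_antisymm
  · rw [vectorSpan_def, Submodule.span_le]
    rintro _ ⟨x, hx, y, hy, rfl⟩ i j ⟨hmem, s, hc⟩
    have h1 := hx.1 i j s hmem hc.1
    have h2 := hy.1 i j s hmem hc.1
    simp only [vsub_eq_sub, Pi.sub_apply]
    linarith
  · intro v hv
    obtain ⟨x, hx⟩ := PhiBar.nonempty hμ A
    obtain ⟨ε, hε, hmem⟩ := exists_add_smul_mem hμ hx hv
    have := vsub_mem_vectorSpan ℝ hmem hx
    rw [vsub_eq_sub, add_sub_cancel_left] at this
    exact (Submodule.smul_mem_iff _ hε).1 this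

lemma ncard_markedBelow (hμ : IsMarking T μ) : (markedBelow T μ).ncard = μ.ncard := by
  choose! par hpar using fun i (hi : i ∈ markedBelow T μ) => hi
  refine Set.ncard_congr (fun i _ => s(i, par i)) (fun i hi => (hpar i hi).1) ?_ ?_
  · intro a b ha hb he
    rcases Sym2.eq_iff.1 he with ⟨h, -⟩ | ⟨h1, h2⟩
    · exact h
    · obtain ⟨-, s, hs⟩ := hpar a ha
      obtain ⟨-, t, ht⟩ := hpar b hb
      have h3 := hs.1.length
      have h4 := ht.1.length
      rw [← h1] at h4
      rw [h2] at h3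
      omega
  · intro e he
    obtain ⟨i, j, s, rfl, hc⟩ := hμ.1 e he
    have hi : i ∈ markedBelow T μ := ⟨j, he, s, hc⟩
    exact ⟨i, hi, by rw [(hpar i hi).left_unique ⟨he, s, hc⟩]⟩

lemma finrank_blockSpace (hμ : IsMarking T μ) :
    Module.finrank ℝ (blockSpace T μ) + μ.ncard = n := by
  classical
  choose! par hpar using fun i (hi : i ∈ markedBelow T μ) => hi
  let L : (Fin n → ℝ) →ₗ[ℝ] (markedBelow T μ → ℝ) :=
    { toFun := fun v i => v i - v (par i)
      map_add' := fun v w => by ext i; simp; ring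
      map_smul' := fun c v => by ext i; simp; ring }
  have hker : LinearMap.ker L = blockSpace T μ := by
    ext v
    rw [LinearMap.mem_ker]
    constructor
    · intro h i j hd
      have hi : i ∈ markedBelow T μ := ⟨j, hd⟩
      have := congrFun h ⟨i, hi⟩
      rw [hd.left_unique (hpar i hi)]
      exact sub_eq_zero.1 this
    · intro h
      ext ⟨i, hi⟩
      exact sub_eq_zero.2 (h i _ (hpar i hi))
  have hrange : LinearMap.range L = ⊤ := by
    rw [LinearMap.range_eq_top]
    intro w
    let g : Fin n → Fin n → ℝ := fun i a => if T.path a <+: T.path i then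
      (if ha : a ∈ markedBelow T μ then w ⟨a, ha⟩ else 0) else 0
    refine ⟨fun i => ∑ a, g i a, ?_⟩
    ext ⟨i, hi⟩
    change (∑ a, g i a) - (∑ a, g (par i) a) = _
    rw [← Finset.sum_sub_distrib, Finset.sum_eq_single i]
    · obtain ⟨-, s, hs⟩ := hpar i hi
      have hnot : ¬ T.path i <+: T.path (par i) := fun h => by
        have := h.length_le
        have := hs.1.length
        omega
      simp [g, hnot, hi]
    · intro a _ ha
      obtain ⟨-, s, hs⟩ := hpar i hi
      have : T.path a <+: T.path i ↔ T.path a <+: T.path (par i) := by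
        rw [show T.path i = _ from hs.1, List.prefix_concat_iff, ← show T.path i = _ from hs.1]
        exact or_iff_right fun e => ha (T.inj e)
      simp only [g, this, sub_self]
    · simp
  have := LinearMap.finrank_range_add_finrank_ker L
  rw [hker, hrange, finrank_top, Module.finrank_fintype_fun_eq_card,
    Module.finrank_fintype_fun_eq_card, Fintype.card_fin, ← Nat.card_eq_fintype_card,
    Nat.card_coe_set_eq, ncard_markedBelow hμ] at this
  omega

theorem PhiBar.faceDim_add_ncard (hμ : IsMarking T μ) (A : Set (Set (Fin n → ℝ))) :
    faceDim n (PhiBar m n A T μ) + μ.ncard = n := by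
  rw [faceDim, direction_eq hμ]
  exact finrank_blockSpace hμ

end Braid

namespace Braid

variable {m n : ℕ} {I : Set (Fin n × Fin n)} {x : Fin n → ℝ} {path : Fin n → List ℕ}

/-- Nodes are ordered by their coordinate, and by their label in case of a tie. -/
def nkey (x : Fin n → ℝ) (i : Fin n) : ℝ ×ₗ Fin n := toLex (x i, i)

lemma nkey_lt {i j : Fin n} : nkey x j < nkey x i ↔ x j < x i ∨ x j = x i ∧ j < i := by
  simp [nkey, Prod.Lex.toLex_lt_toLex]

lemma nkey_injective (x : Fin n → ℝ) : Function.Injective (nkey x) := fun _ _ h =>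
  congrArg (fun z => (ofLex z).2) h

lemma nkey_wf (x : Fin n → ℝ) : WellFounded (fun a b : Fin n => nkey x a < nkey x b) :=
  haveI : IsTrans (Fin n) (fun a b : Fin n => nkey x a < nkey x b) := ⟨fun _ _ _ => lt_trans⟩
  haveI : Std.Irrefl (fun a b : Fin n => nkey x a < nkey x b) := ⟨fun _ => lt_irrefl _⟩
  Finite.wellFounded_of_trans_of_irrefl _

/-- Recursive choice along a well-founded relation. -/
lemma exists_of_wellFounded {α β : Type*} {r : α → α → Prop} (hr : WellFounded r)
    (P : (i : α) → ((j : α) → r j i → β) → β → Prop) (h : ∀ i f, ∃ b, P i f b) :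
    ∃ g : α → β, ∀ i, P i (fun j _ => g j) (g i) := by
  refine ⟨hr.fix fun i f => (h i f).choose, fun i => ?_⟩
  rw [hr.fix_eq]
  exact (h i _).choose_spec

/-- Every node is placed at the greatest slot of the arrangement which it is not below. -/
structure IsGreedy (m : ℕ) (I : Set (Fin n × Fin n)) (x : Fin n → ℝ)
    (path : Fin n → List ℕ) : Prop where
  parent : ∀ i, path i ≠ [] → ∃ j s, nkey x j < nkey x i ∧ InA m I i j s ∧ x j + s ≤ x i ∧
    path i = path j ++ [s]
  slot_le : ∀ i j s, nkey x j < nkey x i → InA m I i j s → x j + s ≤ x i →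
    vkey (path j ++ [s]) ≤ vkey (path i)

lemma exists_isGreedy (hm : 0 < m) (I : Set (Fin n × Fin n)) (x : Fin n → ℝ) :
    ∃ path, IsGreedy m I x path := by
  have := exists_of_wellFounded (β := List ℕ) (nkey_wf x) (fun i f b =>
    (b ≠ [] → ∃ j s, ∃ h : nkey x j < nkey x i, InA m I i j s ∧ x j + s ≤ x i ∧
      b = f j h ++ [s]) ∧
    ∀ j s, ∀ h : nkey x j < nkey x i, InA m I i j s → x j + s ≤ x i →
      vkey (f j h ++ [s]) ≤ vkey b) ?_
  · obtain ⟨path, h⟩ := this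
    refine ⟨path, ⟨fun i hi => ?_, fun i j s h1 h2 h3 => (h i).2 j s h1 h2 h3⟩⟩
    obtain ⟨j, s, h1, h2⟩ := (h i).1 hi
    exact ⟨j, s, h1, h2⟩
  · intro i f
    by_cases hne : ∃ j, nkey x j < nkey x i
    · let S : Set (List ℕ) := {b | ∃ j s, ∃ h : nkey x j < nkey x i, InA m I i j s ∧
        x j + s ≤ x i ∧ b = f j h ++ [s]}
      have hfin : S.Finite := by
        refine (Set.finite_range fun z : {j // nkey x j < nkey x i} × Fin (m + 1) =>
          f z.1.1 z.1.2 ++ [z.2.1]).subset ?_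
        rintro _ ⟨j, s, h, hA, -, rfl⟩
        exact ⟨(⟨j, h⟩, ⟨s, Nat.lt_succ_of_le hA.le⟩), rfl⟩
      obtain ⟨j, hj⟩ := hne
      obtain ⟨b, hb, hmax⟩ := Set.exists_max_image S vkey hfin
        ⟨_, j, 0, hj, Or.inl hm, by
          rcases nkey_lt.1 hj with h | ⟨h, -⟩ <;> push_cast <;> linarith, rfl⟩
      exact ⟨b, fun _ => hb, fun j s h hA hle => hmax _ ⟨j, s, h, hA, hle, rfl⟩⟩
    · exact ⟨[], fun h => absurd rfl h, fun j s h => absurd ⟨j, h⟩ hne⟩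

namespace IsGreedy

lemma vkey_lt_of_nkey_lt (hm : 0 < m) (hg : IsGreedy m I x path) {i j : Fin n}
    (h : nkey x j < nkey x i) : vkey (path j) < vkey (path i) := by
  refine (vkey_lt_append (path j) (l := [0]) (by simp)).trans_le
    (hg.slot_le i j 0 h (Or.inl hm) ?_)
  rcases nkey_lt.1 h with h | ⟨h, -⟩ <;> push_cast <;> linarith

lemma nkey_lt_of_vkey_lt (hm : 0 < m) (hg : IsGreedy m I x path) {i j : Fin n}
    (h : vkey (path j) < vkey (path i)) : nkey x j < nkey x i := by
  rcases lt_trichotomy (nkey x j) (nkey x i) with h' | h' | h'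
  · exact h'
  · rw [nkey_injective x h'] at h
    exact absurd h (lt_irrefl _)
  · exact absurd h (lt_asymm (hg.vkey_lt_of_nkey_lt hm h'))

lemma path_injective (hm : 0 < m) (hg : IsGreedy m I x path) : Function.Injective path := by
  intro i j h
  rcases lt_trichotomy (nkey x j) (nkey x i) with h' | h' | h'
  · exact absurd (hg.vkey_lt_of_nkey_lt hm h') (by simp [h])
  · exact (nkey_injective x h').symm
  · exact absurd (hg.vkey_lt_of_nkey_lt hm h') (by simp [h])

lemma slot_le_of_lt_or_eq (hg : IsGreedy m I x path) {i j : Fin n} {s : ℕ}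
    (hA : InA m I i j s) (h : x j + s < x i ∨ x j + s = x i ∧ (0 < s ∨ j < i)) :
    vkey (path j ++ [s]) ≤ vkey (path i) := by
  have hs : (0 : ℝ) ≤ s := Nat.cast_nonneg s
  refine hg.slot_le i j s (nkey_lt.2 ?_) hA (by rcases h with h | ⟨h, -⟩ <;> linarith)
  rcases h with h | ⟨h, h0 | h0⟩
  · left; linarith
  · left
    have : (0 : ℝ) < s := by exact_mod_cast h0
    linarith
  · rcases hs.eq_or_lt with hs | hs
    · right; exact ⟨by linarith, h0⟩
    · left; linarith

/-- A slot of the arrangement preceding the slot of a node is not above that node. -/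
lemma slot_le_coord (hm : 0 < m) (hI : IsIdeal n I) (hg : IsGreedy m I x path)
    (j i j' : Fin n) (s s' : ℕ) (hji : nkey x j < nkey x i) (hA : InA m I i j s)
    (hle : x j + s ≤ x i) (hA' : InA m I i j' s') (hj'i : nkey x j' < nkey x i)
    (hslot : vkey (path j' ++ [s']) ≤ vkey (path j ++ [s])) :
    x j' + s' ≤ x j + s ∨ x j' + s' < x i := by
  induction j using (nkey_wf x).induction generalizing i j' s s' with
  | _ j ih =>
  by_cases hjj : j' = j
  · subst hjj
    left
    have : (s' : ℝ) ≤ s := by exact_mod_cast vkey_append_singleton_le.1 hslot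
    linarith
  have hpath : path j ≠ path j' := fun e => hjj (hg.path_injective hm e).symm
  rcases le_or_gt s' s with hss | hss
  · by_cases hAj : InA m I j' j (s - s')
    · left
      by_contra hcon
      have hsub : ((s - s' : ℕ) : ℝ) = s - s' := by push_cast [hss]; ring
      have h1 : vkey (path j ++ [s - s']) ≤ vkey (path j') :=
        hg.slot_le_of_lt_or_eq hAj (Or.inl (by rw [hsub]; linarith))
      have h2 := vkey_shift_of_le s' h1
      rw [Nat.sub_add_cancel hss] at h2
      exact absurd hslot (not_le.2 h2)
    · right
      have hsm := hA.le
      have hs0 : s' = 0 ∧ s = m := by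
        by_contra hcon
        exact hAj (Or.inl (by omega))
      obtain ⟨rfl, rfl⟩ := hs0
      simp only [Nat.sub_zero, InA, lt_self_iff_false, true_and, false_or] at hAj hA
      have hij : ¬ j' ≤ i := fun hij => hAj (hI.2 _ hA (j', j) hjj hij le_rfl)
      rcases nkey_lt.1 hj'i with h | ⟨-, h⟩
      · simpa using h
      · exact absurd h.le hij
  · have hsub : ((s' - s : ℕ) : ℝ) = s' - s := by push_cast [hss.le]; ring
    have h1 : vkey (path j' ++ [s' - s]) ≤ vkey (path j) := by
      by_contra hcon
      have h2 := vkey_shift_of_lt s (not_le.1 hcon) hpath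
      rw [Nat.sub_add_cancel hss.le] at h2
      exact absurd hslot (not_le.2 h2)
    have hj'j : nkey x j' < nkey x j :=
      hg.nkey_lt_of_vkey_lt hm ((vkey_lt_append _ (by simp)).trans_le h1)
    have hne : path j ≠ [] := by
      intro e
      rw [e] at h1
      exact absurd h1 (not_le.2 (vkey_nil_lt (by simp)))
    obtain ⟨l, t, hlj, hAl, hlle, hpl⟩ := hg.parent j hne
    rw [hpl] at h1
    by_cases hAj : InA m I j j' (s' - s)
    · left
      have := ih l hlj j j' t (s' - s) hlj hAl hlle hAj hj'j h1
      rw [hsub] at this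
      rcases this with h | h <;> linarith
    · have hs'm := hA'.le
      have hs0 : s = 0 ∧ s' = m := by
        by_contra hcon
        exact hAj (Or.inl (by omega))
      obtain ⟨rfl, rfl⟩ := hs0
      simp only [Nat.sub_zero, InA, lt_self_iff_false, true_and, false_or] at h1 hAj hA'
      have hij : ¬ j ≤ i := fun hij => hAj (hI.2 _ hA' (j, j')
        (fun e => hjj e.symm) hij le_rfl)
      have hlt : x j < x i := by
        rcases nkey_lt.1 hji with h | ⟨-, h⟩
        · exact h
        · exact absurd h.le hij
      have hAi : InA s' I i l t := by
        rcases hAl with h | ⟨h, hjl⟩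
        · exact Or.inl h
        · refine Or.inr ⟨h, hI.2 _ hjl (i, l) ?_ (not_le.1 hij).le le_rfl⟩
          intro e
          rw [← show i = l from e] at hlj
          exact lt_asymm hji hlj
      have := ih l hlj i j' t s' (hlj.trans hji) hAi (by linarith) (Or.inr ⟨rfl, hA'⟩) hj'i h1
      right
      rcases this with h | h
      · linarith
      · exact h

/-- The tree of a greedy placement. -/
def tree (hm : 0 < m) (hg : IsGreedy m I x path) : Tree m n where
  path := path
  entry_le := by
    intro v
    induction v using (nkey_wf x).induction with
    | _ v ih =>
    intro s hs
    by_cases hv : path v = []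
    · simp [hv] at hs
    · obtain ⟨j, t, hj, hA, -, he⟩ := hg.parent v hv
      rw [he, List.mem_append, List.mem_singleton] at hs
      rcases hs with hs | rfl
      · exact ih j hj s hs
      · exact hA.le
  inj := hg.path_injective hm
  parent_closed := by
    intro v hv
    obtain ⟨j, t, -, -, -, he⟩ := hg.parent v hv
    exact ⟨j, by simp [he]⟩

/-- The edges of the greedy tree along which the defining inequality is an equality. -/
def marking (x : Fin n → ℝ) (T : Tree m n) : Set (Sym2 (Fin n)) :=
  {e | ∃ i j s, e = s(i, j) ∧ T.IsChild i j s ∧ x j + s = x i}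

lemma child_spec (hm : 0 < m) (hg : IsGreedy m I x path) {i j : Fin n} {s : ℕ}
    (hc : (hg.tree hm).IsChild i j s) :
    nkey x j < nkey x i ∧ InA m I i j s ∧ x j + s ≤ x i := by
  have he : path i = path j ++ [s] := hc
  obtain ⟨l, t, h1, h2, h3, h4⟩ := hg.parent i (by simp [he])
  obtain ⟨rfl, rfl⟩ := hc.unique (show (hg.tree hm).IsChild i l t from h4)
  exact ⟨h1, h2, h3⟩

lemma mem_marking_iff {T : Tree m n} {i j : Fin n} {s : ℕ} (hc : T.IsChild i j s) :
    s(i, j) ∈ marking x T ↔ x j + s = x i := by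
  constructor
  · rintro ⟨a, b, t, he, hc', hx⟩
    rcases Sym2.eq_iff.1 he with ⟨rfl, rfl⟩ | ⟨rfl, rfl⟩
    · rwa [(hc.unique hc').2]
    · have := hc.length
      have := hc'.length
      omega
  · exact fun h => ⟨i, j, s, rfl, hc, h⟩

lemma isMarking (hm : 0 < m) (hI : IsIdeal n I) (hg : IsGreedy m I x path) :
    IsMarking (hg.tree hm) (marking x (hg.tree hm)) := by
  constructor
  · rintro _ ⟨i, j, s, rfl, hc, hx⟩
    refine ⟨i, j, s, rfl, hc, ?_⟩
    rintro t hst htm ⟨k, hk⟩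
    obtain ⟨h1, hA, -⟩ := hg.child_spec hm hc
    obtain ⟨-, hAk, hk3⟩ := hg.child_spec hm hk
    have hki : k ≠ i := by
      rintro rfl
      have := (hc.unique hk).2
      omega
    have hsub : ((t - s : ℕ) : ℝ) = t - s := by push_cast [hst.le]; ring
    have hAki : InA m I k i (t - s) := by
      by_contra hcon
      have hs0 : s = 0 ∧ t = m := by
        by_contra h
        exact hcon (Or.inl (by omega))
      obtain ⟨rfl, rfl⟩ := hs0
      simp only [Nat.sub_zero, InA, lt_self_iff_false, true_and, false_or] at hcon hAk
      refine hcon (hI.2 _ hAk (k, i) hki le_rfl ?_)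
      rcases nkey_lt.1 h1 with h | ⟨-, h⟩
      · push_cast at hx
        linarith
      · exact h.le
    have hle : vkey (path i ++ [t - s]) ≤ vkey (path k) := by
      have hpos : (0 : ℝ) < t - s := by
        rw [← hsub]
        exact_mod_cast Nat.sub_pos_of_lt hst
      exact hg.slot_le k i (t - s) (nkey_lt.2 (Or.inl (by linarith))) hAki
        (by rw [hsub]; linarith)
    have h2 := vkey_shift_of_le (t - s)
      (congrArg vkey (show path i = path j ++ [s] from hc)).ge
    rw [Nat.add_sub_cancel' hst.le, ← show path k = path j ++ [t] from hk] at h2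
    exact absurd hle (not_le.2 h2)
  · intro i j hmem hc
    rw [mem_marking_iff hc.1] at hmem
    rcases nkey_lt.1 (hg.child_spec hm hc.1).1 with h | ⟨-, h⟩
    · push_cast at hmem
      linarith
    · exact h

lemma simMu_of_eq (hm : 0 < m) (hI : IsIdeal n I) (hg : IsGreedy m I x path) {i j : Fin n}
    {s : ℕ} (hA : InA m I i j s) (hs : 0 < s ∨ j < i) (he : x j + s = x i) :
    simMu (marking x (hg.tree hm)) i j := by
  induction i using (nkey_wf x).induction generalizing s with
  | _ i ih =>
  have hle := hg.slot_le_of_lt_or_eq hA (Or.inr ⟨he, hs⟩)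
  have hji : nkey x j < nkey x i :=
    hg.nkey_lt_of_vkey_lt hm ((vkey_lt_append _ (by simp)).trans_le hle)
  have hne : path i ≠ [] := by
    intro e
    rw [e] at hle
    exact absurd hle (not_le.2 (vkey_nil_lt (by simp)))
  obtain ⟨l, t, hli, hAl, hlt, hpl⟩ := hg.parent i hne
  have hc : (hg.tree hm).IsChild i l t := hpl
  rw [hpl] at hle
  have hxl : x l + t = x i := by
    rcases hg.slot_le_coord hm hI l i j t s hli hAl hlt hA hji hle with h | h <;> linarith
  have hil : s(i, l) ∈ marking x (hg.tree hm) := (mem_marking_iff hc).2 hxl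
  by_cases hjl : l = j
  · rw [← hjl]
    exact .single hil
  have hpath : path l ≠ path j := fun e => hjl (hg.path_injective hm e)
  refine Relation.ReflTransGen.head hil ?_
  rcases le_or_gt t s with hts | hts
  · have hsub : ((s - t : ℕ) : ℝ) = s - t := by push_cast [hts]; ring
    have h1 : vkey (path j ++ [s - t]) ≤ vkey (path l) := by
      by_contra hcon
      have h2 := vkey_shift_of_lt t (not_le.1 hcon) hpath
      rw [Nat.sub_add_cancel hts] at h2
      exact absurd hle (not_le.2 h2)
    have hjl' : nkey x j < nkey x l :=
      hg.nkey_lt_of_vkey_lt hm ((vkey_lt_append _ (by simp)).trans_le h1)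
    refine ih l hli (s := s - t) ?_ ?_ (by rw [hsub]; linarith)
    · by_contra hcon
      have hsm := hA.le
      have hs0 : t = 0 ∧ s = m := by
        by_contra h
        exact hcon (Or.inl (by omega))
      obtain ⟨rfl, rfl⟩ := hs0
      simp only [Nat.sub_zero, InA, lt_self_iff_false, true_and, false_or] at hcon hA
      refine hcon (hI.2 _ hA (l, j) hjl ?_ le_rfl)
      rcases nkey_lt.1 hli with h | ⟨-, h⟩
      · push_cast at hxl
        linarith
      · exact h.le
    · by_contra hcon
      push Not at hcon
      have hst : s = t := by omega
      subst hst
      rcases nkey_lt.1 hjl' with h | ⟨-, h⟩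
      · linarith
      · exact absurd h (not_lt.2 hcon.2)
  · exfalso
    have hsub : ((t - s : ℕ) : ℝ) = t - s := by push_cast [hts.le]; ring
    have hAj : InA m I j l (t - s) := by
      by_contra hcon
      have htm := hAl.le
      have hs0 : s = 0 ∧ t = m := by
        by_contra h
        exact hcon (Or.inl (by omega))
      obtain ⟨rfl, rfl⟩ := hs0
      simp only [Nat.sub_zero, InA, lt_self_iff_false, true_and, false_or] at hcon hAl hs
      exact hcon (hI.2 _ hAl (j, l) (fun e => hjl e.symm) hs.le le_rfl)
    have h1 : vkey (path l ++ [t - s]) ≤ vkey (path j) :=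
      hg.slot_le_of_lt_or_eq hAj (Or.inr ⟨by rw [hsub]; linarith, Or.inl (by omega)⟩)
    have h2 := vkey_shift_of_le s h1
    rw [Nat.sub_add_cancel hts.le] at h2
    exact absurd hle (not_le.2 h2)

theorem mem_PhiBar (hm : 0 < m) (hI : IsIdeal n I) (hg : IsGreedy m I x path) :
    x ∈ PhiBar m n (BmI m n I) (hg.tree hm) (marking x (hg.tree hm)) := by
  refine ⟨fun i j s hmem hc => ?_, fun i j s h hsim => ?_⟩
  · rw [mem_marking_iff hc] at hmem
    linarith
  · obtain ⟨hij, hs, hA⟩ := (trIdxA_BmI hm hI).1 h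
    rw [vlt_iff, vge_iff]
    change (vkey (path i) < vkey (path j ++ [s]) → _) ∧ (vkey (path j ++ [s]) ≤ vkey (path i) → _)
    constructor
    · intro hlt
      by_contra hcon
      rcases (not_lt.1 hcon).eq_or_lt with he | hgt
      · exact absurd (hg.slot_le_of_lt_or_eq hA (Or.inr ⟨by linarith, hs⟩)) (not_le.2 hlt)
      · exact absurd (hg.slot_le_of_lt_or_eq hA (Or.inl (by linarith))) (not_le.2 hlt)
    · intro hle
      have hji : nkey x j < nkey x i :=
        hg.nkey_lt_of_vkey_lt hm ((vkey_lt_append _ (by simp)).trans_le hle)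
      have hne : path i ≠ [] := by
        intro e
        rw [e] at hle
        exact absurd hle (not_le.2 (vkey_nil_lt (by simp)))
      obtain ⟨l, t, hli, hAl, hlt, hpl⟩ := hg.parent i hne
      rw [hpl] at hle
      have hxx : x j + s ≤ x i := by
        rcases hg.slot_le_coord hm hI l i j t s hli hAl hlt hA hji hle with h | h <;> linarith
      have hxne : x j + s ≠ x i := fun he => hsim (hg.simMu_of_eq hm hI hA hs he)
      have := lt_of_le_of_ne hxx hxne
      linarith

end IsGreedy

theorem PhiBar.exists_mem (hm : 0 < m) (hI : IsIdeal n I) (x : Fin n → ℝ) :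
    ∃ (T : Tree m n) (μ : Set (Sym2 (Fin n))), IsMarking T μ ∧
      (∀ i j : Fin n, T.IsChild i j m → (i, j) ∈ I) ∧ x ∈ PhiBar m n (BmI m n I) T μ := by
  obtain ⟨path, hg⟩ := exists_isGreedy hm I x
  refine ⟨hg.tree hm, IsGreedy.marking x (hg.tree hm), hg.isMarking hm hI, fun i j hc => ?_,
    hg.mem_PhiBar hm hI⟩
  rcases (hg.child_spec hm hc).2.1 with h | ⟨-, h⟩
  · omega
  · exact h

lemma BmI_form (hI : IsIdeal n I) : ∀ H ∈ BmI m n I, ∃ (i j : Fin n) (s : ℝ),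
    i ≠ j ∧ H = hyp n i j s := fun H hH => by
  obtain ⟨i, j, s, hij, -, h⟩ := exists_nat_of_hyp_mem_BmI hI hH
  exact ⟨i, j, s, hij, h⟩

end Braid

/-- For an ideal `I ⊆ R_n`, the arrangement `A = B_{m,I}^n ⊆ A_m^n` is strongly transitive, the
marked trees in `ŌT_m^n(A)` are those for which `i = m`-child`(j)` implies `(i,j) ∈ I`, and for
each `k` the map `Φ̄_A` is a bijection from the set of such marked trees with `k` marked edges
onto the set of faces of `A` of codimension `k`. -/
theorem ideal_interpolation_faces (m n : ℕ) (hm : 0 < m) (hn : 0 < n)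
    (I : Set (Fin n × Fin n)) (hI : Braid.IsIdeal n I) :
    (Braid.BmI m n I ⊆ Braid.catArr m n ∧ Braid.IsStronglyTransitive n (Braid.BmI m n I)) ∧
    Braid.OTset m n (Braid.BmI m n I) =
      {p ∈ Braid.OTall m n | ∀ i j : Fin n, p.1.IsChild i j m → (i, j) ∈ I} ∧
    ∀ k : ℕ,
      Set.BijOn
        (fun p : Braid.Tree m n × Set (Sym2 (Fin n)) =>
          Braid.PhiBar m n (Braid.BmI m n I) p.1 p.2)
        {p ∈ Braid.OTall m n |
          (∀ i j : Fin n, p.1.IsChild i j m → (i, j) ∈ I) ∧ p.2.ncard = k}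
        {F | Braid.IsFace n (Braid.BmI m n I) F ∧ Braid.faceDim n F + k = n} := by
  refine ⟨⟨Braid.BmI_subset_catArr hI, Braid.isStronglyTransitive_BmI hm hI⟩,
    Braid.OTset_BmI hm hI, fun k => ⟨?_, ?_, ?_⟩⟩
  · rintro ⟨T, μ⟩ ⟨hμ, hT, hk⟩
    obtain ⟨x, hx⟩ := Braid.PhiBar.nonempty hμ (Braid.BmI m n I)
    refine ⟨?_, ?_⟩
    · change Braid.IsFace n _ (Braid.PhiBar m n _ T μ)
      rw [Braid.PhiBar.eq_signClass hm hI hμ hT hx]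
      exact Braid.isFace_signClass (Braid.BmI_form hI) x
    · rw [← hk]
      exact Braid.PhiBar.faceDim_add_ncard hμ _
  · rintro ⟨T, μ⟩ ⟨hμ, hT, -⟩ ⟨T', μ'⟩ ⟨hμ', hT', -⟩ he
    obtain ⟨x, hx⟩ := Braid.PhiBar.nonempty hμ (Braid.BmI m n I)
    have hx' : x ∈ Braid.PhiBar m n (Braid.BmI m n I) T' μ' :=
      (show Braid.PhiBar m n (Braid.BmI m n I) T μ = Braid.PhiBar m n (Braid.BmI m n I) T' μ'
        from he) ▸ hx
    obtain ⟨rfl, rfl⟩ := Braid.PhiBar.unique hm hI hμ hμ' hT hT' hx hx'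
    rfl
  · rintro F ⟨hF, hdim⟩
    obtain ⟨x, hxF⟩ := hF.1
    obtain ⟨T, μ, hμ, hT, hx⟩ := Braid.PhiBar.exists_mem hm hI x
    have hEq : Braid.PhiBar m n (Braid.BmI m n I) T μ = F := by
      rw [Braid.PhiBar.eq_signClass hm hI hμ hT hx,
        hF.eq_signClass (Braid.BmI_form hI) hxF]
    refine ⟨(T, μ), ⟨hμ, hT, ?_⟩, hEq⟩
    have := Braid.PhiBar.faceDim_add_ncard hμ (Braid.BmI m n I)
    rw [hEq] at this
    change μ.ncard = k
    omega
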